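/- arXiv:2509.24538 — 2 statements merged into one kernel-verified Lean document; each statement's English description precedes it below -/
import Mathlib

section
/- Let α ∈ (0,1) and let m_N, k_N be sequences of natural numbers with p_N := m_N·k_N = ⌊N^α⌋ (so p_N → ∞ and p_N = o(N)). For each N let A_N be Haar-distributed on O(N) and let ν_N = (1/p_N) ∑_{i=1}^{m_N} ∑_{j=1}^{k_N} δ_{√N·(A_N)_{i,j}}. Then with probability 1, the sequence ν_N converges weakly to the standard Gaussian measure γ as N → ∞. -/
open MeasureTheory ProbabilityTheory Filter Matrix

noncomputable instance matrixMeasurableSpace {N : ℕ} :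
    MeasurableSpace (Matrix (Fin N) (Fin N) ℝ) :=
  show MeasurableSpace (Fin N → Fin N → ℝ) from inferInstance

/-- The `(i,j)` entry of `A` (with `0`-based indices), or `0` if out of range. -/
def entryOrZero {N : ℕ} (A : Matrix (Fin N) (Fin N) ℝ) (i j : ℕ) : ℝ :=
  if h : i < N ∧ j < N then A ⟨i, h.1⟩ ⟨j, h.2⟩ else 0

/-- The empirical measure `(1/(m*k)) ∑_{i<m} ∑_{j<k} δ_{√N · A_{i,j}}`. -/
noncomputable def empMeas (m k N : ℕ) (A : Matrix (Fin N) (Fin N) ℝ) : Measure ℝ :=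
  ((m * k : ℕ) : ENNReal)⁻¹ •
    ∑ i ∈ Finset.range m, ∑ j ∈ Finset.range k,
      Measure.dirac (Real.sqrt N * entryOrZero A i j)

open scoped Classical in
/-- The empirical measure as a probability measure (junk value if `m*k = 0`). -/
noncomputable def empPM (m k N : ℕ) (A : Matrix (Fin N) (Fin N) ℝ) :
    ProbabilityMeasure ℝ :=
  if h : IsProbabilityMeasure (empMeas m k N A) then ⟨empMeas m k N A, h⟩
  else ⟨Measure.dirac 0, inferInstance⟩

section
variable {ι : Type*} [Fintype ι]

/-- The law of a family of independent standard Gaussians. -/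
noncomputable abbrev gaussianPi (ι : Type*) [Fintype ι] : Measure (ι → ℝ) :=
  Measure.pi fun _ => gaussianReal 0 1

lemma map_gaussianPi_of_sum_sq_eq (T : (ι → ℝ) →ₗ[ℝ] (ι → ℝ))
    (hT : ∀ x, ∑ i, T x i ^ 2 = ∑ i, x i ^ 2) :
    (gaussianPi ι).map T = gaussianPi ι := by
  let e := WithLp.linearEquiv 2 ℝ (ι → ℝ)
  let f : EuclideanSpace ℝ ι →ₗᵢ[ℝ] EuclideanSpace ℝ ι :=
    { toLinearMap := e.symm.toLinearMap ∘ₗ T ∘ₗ e.toLinearMap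
      norm_map' := fun x => by
        rw [← sq_eq_sq₀ (norm_nonneg _) (norm_nonneg _), EuclideanSpace.real_norm_sq_eq,
          EuclideanSpace.real_norm_sq_eq]
        exact hT _ }
  let g := f.toLinearIsometryEquiv rfl
  have hTm : Measurable T := T.continuous_of_finiteDimensional.measurable
  have h1 : (T : (ι → ℝ) → ι → ℝ) = WithLp.ofLp ∘ g ∘ WithLp.toLp 2 := rfl
  have h2 : (gaussianPi ι)
      = (stdGaussian (EuclideanSpace ℝ ι)).map WithLp.ofLp := by
    rw [← map_pi_eq_stdGaussian, Measure.map_map (by fun_prop) (by fun_prop)]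
    simp [Function.comp_def]
  rw [h1, ← Measure.map_map (by fun_prop) (g.continuous.measurable.comp (by fun_prop)),
    ← Measure.map_map g.continuous.measurable (by fun_prop), map_pi_eq_stdGaussian,
    stdGaussian_map, h2]

end

section
open scoped Matrix.Norms.L2Operator
variable {ι : Type*} [Fintype ι] [DecidableEq ι]

lemma Matrix.l2_opNorm_le_of_sum_sq_le {A : Matrix ι ι ℝ} {δ : ℝ} (hδ : 0 ≤ δ)
    (hA : ∑ i, ∑ j, A i j ^ 2 ≤ δ ^ 2) : ‖A‖ ≤ δ := by
  rw [← Matrix.l2_opNorm_toEuclideanCLM (𝕜 := ℝ)]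
  refine ContinuousLinearMap.opNorm_le_bound _ hδ fun x => ?_
  rw [← sq_le_sq₀ (norm_nonneg _) (by positivity), mul_pow, EuclideanSpace.real_norm_sq_eq,
    EuclideanSpace.real_norm_sq_eq]
  calc _ ≤ ∑ i, (∑ j, A i j ^ 2) * ∑ j, x j ^ 2 := by
        refine Finset.sum_le_sum fun i _ => ?_
        exact Finset.sum_mul_sq_le_sq_mul_sq _ _ _
    _ ≤ _ := by
        rw [← Finset.sum_mul]
        gcongr

lemma abs_one_sub_inv_sqrt_le {x δ : ℝ} (hδ : δ ≤ 1 / 2) (hx : |x - 1| ≤ δ) :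
    |1 - (√x)⁻¹| ≤ δ := by
  have h := abs_le.1 hx
  have hx0 : (1 / 2 : ℝ) ≤ x := by linarith [h.1]
  have hs : (7 / 10 : ℝ) ≤ √x := Real.le_sqrt_of_sq_le (by linarith)
  have hsx : √x * √x = x := Real.mul_self_sqrt (by linarith)
  have hpos : 0 < √x := by linarith
  have : 1 - (√x)⁻¹ = (x - 1) * ((√x + 1) * √x)⁻¹ := by
    field_simp
    nlinarith
  rw [this, abs_mul, abs_of_pos (by positivity : 0 < ((√x + 1) * √x)⁻¹)]
  refine (mul_le_of_le_one_right (abs_nonneg _) ?_).trans hx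
  exact inv_le_one_of_one_le₀ (by nlinarith)

/-- A self-adjoint element close to `1` has an inverse square root close to `1`. -/
lemma IsSelfAdjoint.exists_inv_sqrt_near_one {A : Type*} [NormedRing A] [StarRing A]
    [NormedAlgebra ℝ A] [IsometricContinuousFunctionalCalculus ℝ A IsSelfAdjoint] {a : A}
    (ha : IsSelfAdjoint a) {δ : ℝ} (hδ0 : 0 ≤ δ) (hδ : δ ≤ 1 / 2) (haδ : ‖a - 1‖ ≤ δ) :
    ∃ s : A, IsSelfAdjoint s ∧ s * a * s = 1 ∧ ‖1 - s‖ ≤ δ := by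
  have hspec : ∀ x ∈ spectrum ℝ a, |x - 1| ≤ δ := fun x hx => by
    have h1 : cfc (fun x : ℝ => x - 1) a = a - 1 := by
      rw [cfc_sub (fun x : ℝ => x) (fun _ => 1) a, cfc_id' ℝ a, cfc_const_one ℝ a]
    refine (norm_apply_le_norm_cfc (fun x : ℝ => x - 1) a hx).trans ?_
    rwa [h1]
  have hpos : ∀ x ∈ spectrum ℝ a, 0 < √x := fun x hx => by
    have := abs_le.1 (hspec x hx)
    exact Real.sqrt_pos.2 (by linarith [this.1])
  have hc : ContinuousOn (fun x : ℝ => (√x)⁻¹) (spectrum ℝ a) :=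
    ContinuousOn.inv₀ (by fun_prop) fun x hx => (hpos x hx).ne'
  have hcx : ContinuousOn (fun x : ℝ => (√x)⁻¹ * x) (spectrum ℝ a) := hc.mul continuousOn_id
  refine ⟨cfc (fun x : ℝ => (√x)⁻¹) a, cfc_predicate _ _, ?_, ?_⟩
  · nth_rw 2 [← cfc_id' ℝ a]
    rw [← cfc_mul (fun x : ℝ => (√x)⁻¹) (fun x => x) a hc continuousOn_id,
      ← cfc_mul (fun x : ℝ => (√x)⁻¹ * x) (fun x => (√x)⁻¹) a hcx hc, ← cfc_const_one ℝ a]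
    refine cfc_congr fun x hx => ?_
    have := hpos x hx
    have h3 : √x * √x = x := Real.mul_self_sqrt (Real.sqrt_pos.1 this).le
    field_simp
    nlinarith
  · rw [← cfc_const_one ℝ a, ← cfc_sub (fun _ => 1) (fun x : ℝ => (√x)⁻¹) a continuousOn_const hc]
    exact norm_cfc_le hδ0 fun x hx => abs_one_sub_inv_sqrt_le hδ (hspec x hx)

/-- A symmetric matrix close to `1` has an inverse square root close to `1`. -/
lemma Matrix.exists_inv_sqrt_near_one {V : Matrix ι ι ℝ} (hV : V.IsSymm) {δ : ℝ} (hδ0 : 0 ≤ δ)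
    (hδ : δ ≤ 1 / 2) (hVδ : ∑ i, ∑ j, (V - 1) i j ^ 2 ≤ δ ^ 2) :
    ∃ S : Matrix ι ι ℝ, S * V * Sᵀ = 1 ∧
      ∀ v : ι → ℝ, ∑ i, (v i - (S *ᵥ v) i) ^ 2 ≤ δ ^ 2 * ∑ i, v i ^ 2 := by
  have hsa : IsSelfAdjoint V := hV
  obtain ⟨S, hS, hSV, hn⟩ :=
    hsa.exists_inv_sqrt_near_one hδ0 hδ (Matrix.l2_opNorm_le_of_sum_sq_le hδ0 hVδ)
  have ht : Sᵀ = S := hS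
  refine ⟨S, by rw [ht, hSV], fun v => ?_⟩
  have := (Matrix.l2_opNorm_mulVec (1 - S) (WithLp.toLp 2 v)).trans
    (mul_le_mul_of_nonneg_right hn (norm_nonneg _))
  rw [← sq_le_sq₀ (norm_nonneg _) (by positivity), mul_pow, EuclideanSpace.real_norm_sq_eq,
    EuclideanSpace.real_norm_sq_eq] at this
  simpa [Matrix.sub_mulVec] using this

end

lemma Matrix.exists_orthogonal_extension {m N : ℕ} (hmN : m ≤ N) {Q : Matrix (Fin m) (Fin N) ℝ}
    (hQ : Q * Qᵀ = 1) :
    ∃ O : Matrix (Fin N) (Fin N) ℝ, O * Oᵀ = 1 ∧ ∀ i, O (Fin.castLE hmN i) = Q i := by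
  let v : Fin N → EuclideanSpace ℝ (Fin N) := fun j =>
    if h : (j : ℕ) < m then WithLp.toLp 2 (Q ⟨j, h⟩) else 0
  let s : Set (Fin N) := {j | (j : ℕ) < m}
  have hv : Orthonormal ℝ (s.domRestrict v) := by
    rw [orthonormal_iff_ite]
    rintro ⟨i, hi⟩ ⟨j, hj⟩
    have h1 := congrFun (congrFun hQ ⟨j, hj⟩) ⟨i, hi⟩
    have hi' : (i : ℕ) < m := hi
    have hj' : (j : ℕ) < m := hj
    simp only [Matrix.mul_apply, Matrix.transpose_apply, Matrix.one_apply, Fin.mk.injEq] at h1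
    simp only [Set.domRestrict_apply, v, hi', hj', dif_pos, PiLp.inner_apply, Subtype.mk.injEq,
      Fin.ext_iff]
    simpa [eq_comm] using h1
  obtain ⟨b, hb⟩ := hv.exists_orthonormalBasis_extension_of_card_eq (by simp)
  refine ⟨Matrix.of fun i l => b i l, ?_, fun i => ?_⟩
  · ext i j
    have := orthonormal_iff_ite.1 b.orthonormal j i
    simp only [PiLp.inner_apply] at this
    simpa [Matrix.mul_apply, Matrix.one_apply, eq_comm] using this
  · have : Fin.castLE hmN i ∈ s := i.2
    ext l
    simp [hb _ this, v]

section OrthogonalInvariance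
variable {N : ℕ}

lemma measurable_matrix_entry (i j : Fin N) :
    Measurable fun A : Matrix (Fin N) (Fin N) ℝ => A i j :=
  (measurable_pi_apply j).comp (measurable_pi_apply (X := fun _ => Fin N → ℝ) i)

lemma measurable_matrix_of_entry {Ω : Type*} [MeasurableSpace Ω]
    {F : Ω → Matrix (Fin N) (Fin N) ℝ} (hF : ∀ i j, Measurable fun ω => F ω i j) : Measurable F :=
  measurable_pi_iff.2 fun i => measurable_pi_iff.2 fun j => hF i j

lemma measurable_matrix_transpose :
    Measurable (Matrix.transpose : Matrix (Fin N) (Fin N) ℝ → Matrix (Fin N) (Fin N) ℝ) :=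
  measurable_matrix_of_entry fun i j => measurable_matrix_entry j i

lemma Measurable.matrix_mul {Ω : Type*} [MeasurableSpace Ω]
    {F G : Ω → Matrix (Fin N) (Fin N) ℝ} (hF : Measurable F) (hG : Measurable G) :
    Measurable fun ω => F ω * G ω := by
  refine measurable_matrix_of_entry fun i j => ?_
  simp only [Matrix.mul_apply]
  exact Finset.measurable_sum _ fun l _ =>
    ((measurable_matrix_entry i l).comp hF).mul ((measurable_matrix_entry l j).comp hG)

lemma ae_orthogonal {μ : Measure (Matrix (Fin N) (Fin N) ℝ)} [IsProbabilityMeasure μ]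
    (hμ : μ {A | A * Aᵀ = 1} = 1) : ∀ᵐ A ∂μ, A * Aᵀ = 1 := by
  refine (mem_ae_iff_prob_eq_one ?_).2 hμ
  have : {A : Matrix (Fin N) (Fin N) ℝ | A * Aᵀ = 1}
      = ⋂ i, ⋂ j, {A | (A * Aᵀ) i j = (1 : Matrix (Fin N) (Fin N) ℝ) i j} := by
    ext A
    simp [← Matrix.ext_iff]
  rw [this]
  refine MeasurableSet.iInter fun i => MeasurableSet.iInter fun j => ?_
  exact measurableSet_eq_fun
    ((measurable_matrix_entry i j).comp (measurable_id.matrix_mul measurable_matrix_transpose))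
    measurable_const

/-- A left-invariant probability measure on the orthogonal group is invariant under inversion. -/
lemma map_transpose_eq_of_left_invariant {μ : Measure (Matrix (Fin N) (Fin N) ℝ)}
    [IsProbabilityMeasure μ] (hμ : μ {A | A * Aᵀ = 1} = 1)
    (hinv : ∀ B : Matrix (Fin N) (Fin N) ℝ, B * Bᵀ = 1 → μ.map (fun A => B * A) = μ) :
    μ.map Matrix.transpose = μ := by
  have hmeas : Measurable fun p : Matrix (Fin N) (Fin N) ℝ × Matrix (Fin N) (Fin N) ℝ =>
      p.1ᵀ * p.2 := (measurable_matrix_transpose.comp measurable_fst).matrix_mul measurable_snd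
  have hlaw : (μ.prod μ).map (fun p => p.1ᵀ * p.2) = μ := by
    ext s hs
    rw [Measure.map_apply hmeas hs, Measure.prod_apply (hmeas hs)]
    have : ∀ᵐ C ∂μ, μ (Prod.mk C ⁻¹' ((fun p => p.1ᵀ * p.2) ⁻¹' s)) = μ s := by
      filter_upwards [ae_orthogonal hμ] with C hC
      have h1 := hinv Cᵀ (by rw [Matrix.transpose_transpose]; exact mul_eq_one_comm.1 hC)
      have h2 := Measure.map_apply (μ := μ)
        (measurable_const.matrix_mul measurable_id : Measurable fun A => Cᵀ * A) hs
      rw [h1] at h2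
      exact h2.symm
    rw [lintegral_congr_ae this]
    simp
  conv_lhs => rw [← hlaw]
  conv_rhs => rw [← hlaw, ← Measure.prod_swap, Measure.map_map hmeas measurable_swap]
  rw [Measure.map_map measurable_matrix_transpose hmeas]
  congr 1
  ext p : 1
  simp [Matrix.transpose_mul]

end OrthogonalInvariance

/-- The Gram matrix of the rows of `g`, normalised by their dimension. -/
noncomputable def rowGram {m N : ℕ} (g : Fin m × Fin N → ℝ) : Matrix (Fin m) (Fin m) ℝ :=
  Matrix.of fun i j => (N : ℝ)⁻¹ * ∑ l, g (i, l) * g (j, l)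

lemma measurable_rowGram_error {m N : ℕ} :
    Measurable fun g : Fin m × Fin N → ℝ => ∑ i, ∑ j, (rowGram g - 1) i j ^ 2 := by
  unfold rowGram
  simp only [Matrix.sub_apply, Matrix.of_apply]
  fun_prop

/-- Comparison of the first rows of a Haar orthogonal matrix with a Gaussian matrix `g`: the
events are compared by multiplying `g` on the right by an independent Haar matrix. -/
lemma orthogonal_block_mul_gaussian_le {m N : ℕ} (hmN : m ≤ N) (hN : 0 < N)
    {μ : Measure (Matrix (Fin N) (Fin N) ℝ)}
    [IsProbabilityMeasure μ] (hμ : μ {A | A * Aᵀ = 1} = 1)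
    (hinv : ∀ B : Matrix (Fin N) (Fin N) ℝ, B * Bᵀ = 1 → μ.map (fun A => B * A) = μ)
    {δ : ℝ} (hδ0 : 0 ≤ δ) (hδ : δ ≤ 1 / 2) {B E : Set (Fin m × Fin N → ℝ)}
    (hB : MeasurableSet B) (hE : MeasurableSet E)
    (hBE : ∀ S : Matrix (Fin m) (Fin m) ℝ,
      (∀ v, ∑ i, (v i - (S *ᵥ v) i) ^ 2 ≤ δ ^ 2 * ∑ i, v i ^ 2) →
      ∀ h ∉ E, (fun p => (S *ᵥ fun i => h (i, p.2)) p.1) ∉ B) :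
    μ {A | (fun p : Fin m × Fin N => √N * A (Fin.castLE hmN p.1) p.2) ∈ B} *
      gaussianPi (Fin m × Fin N)
        {g | ∑ i, ∑ j, (rowGram g - 1) i j ^ 2 ≤ δ ^ 2} ≤
      gaussianPi (Fin m × Fin N) E := by
  set Γ := gaussianPi (Fin m × Fin N)
  let T : Matrix (Fin N) (Fin N) ℝ → (Fin m × Fin N → ℝ) → Fin m × Fin N → ℝ :=
    fun A g p => ∑ l, g (p.1, l) * A l p.2
  have hT : Measurable fun q : (Fin m × Fin N → ℝ) × Matrix (Fin N) (Fin N) ℝ => T q.2 q.1 := by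
    refine measurable_pi_iff.2 fun p => Finset.measurable_sum _ fun l _ => ?_
    exact ((measurable_pi_apply _).comp measurable_fst).mul
      ((measurable_matrix_entry _ _).comp measurable_snd)
  have hblock : Measurable fun A : Matrix (Fin N) (Fin N) ℝ =>
      fun p : Fin m × Fin N => √N * A (Fin.castLE hmN p.1) p.2 :=
    measurable_pi_iff.2 fun p => measurable_const.mul (measurable_matrix_entry _ _)
  have hgood : MeasurableSet {g : Fin m × Fin N → ℝ | ∑ i, ∑ j, (rowGram g - 1) i j ^ 2 ≤ δ ^ 2} :=
    measurable_rowGram_error measurableSet_Iic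
  have hfix_g : ∀ g, ∑ i, ∑ j, (rowGram g - 1) i j ^ 2 ≤ δ ^ 2 →
      μ {A | (fun p : Fin m × Fin N => √N * A (Fin.castLE hmN p.1) p.2) ∈ B}
        ≤ μ {A | T A g ∈ E} := by
    intro g hg
    have hsymm : (rowGram g).IsSymm := by
      ext i j
      simp [rowGram, mul_comm]
    obtain ⟨S, hS, hSδ⟩ := Matrix.exists_inv_sqrt_near_one hsymm hδ0 hδ hg
    let G : Matrix (Fin m) (Fin N) ℝ := Matrix.of fun i l => g (i, l)
    have hN' : (0 : ℝ) < √N := Real.sqrt_pos.2 (by exact_mod_cast hN)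
    have hGG : rowGram g = ((√N)⁻¹ • G) * ((√N)⁻¹ • G)ᵀ := by
      ext i j
      simp only [rowGram, Matrix.of_apply, Matrix.mul_apply, Matrix.smul_apply,
        Matrix.transpose_apply, smul_eq_mul, G, Finset.mul_sum]
      refine Finset.sum_congr rfl fun l _ => ?_
      rw [mul_mul_mul_comm, ← mul_inv, Real.mul_self_sqrt (by positivity)]
    obtain ⟨O, hO, hOS⟩ := Matrix.exists_orthogonal_extension hmN (Q := S * ((√N)⁻¹ • G)) (by
      rw [Matrix.transpose_mul, ← hS, hGG]
      simp only [Matrix.mul_assoc])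
    calc _ = μ {A | (fun p : Fin m × Fin N => √N * (O * A) (Fin.castLE hmN p.1) p.2) ∈ B} := by
          conv_lhs => rw [← hinv O hO]
          exact Measure.map_apply (measurable_const.matrix_mul measurable_id) (hblock hB)
      _ ≤ _ := by
          refine measure_mono fun A hA => ?_
          by_contra hAE
          refine hBE S hSδ (T A g) hAE ?_
          convert (show _ ∈ B from hA) using 1
          ext p
          have h1 : (O * A) (Fin.castLE hmN p.1) p.2 = (S * ((√N)⁻¹ • G) * A) p.1 p.2 := by
            simp only [Matrix.mul_apply (M := O), Matrix.mul_apply (N := A), hOS]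
          have h2 : (S *ᵥ fun i => T A g (i, p.2)) p.1 = (S * (G * A)) p.1 p.2 := by
            simp [Matrix.mulVec, dotProduct, Matrix.mul_apply, T, G]
          rw [h1, h2, Matrix.mul_smul, Matrix.smul_mul, Matrix.smul_apply, smul_eq_mul,
            mul_inv_cancel_left₀ hN'.ne', Matrix.mul_assoc]
  have hfix_A : ∀ᵐ A ∂μ, Γ {g | T A g ∈ E} = Γ E := by
    filter_upwards [ae_orthogonal hμ] with A hA
    let L : (Fin m × Fin N → ℝ) →ₗ[ℝ] (Fin m × Fin N → ℝ) :=
      { toFun := T A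
        map_add' := fun x y => by ext p; simp [T, add_mul, Finset.sum_add_distrib]
        map_smul' := fun c x => by ext p; simp [T, Finset.mul_sum, mul_assoc] }
    have hL : Γ.map L = Γ := by
      refine map_gaussianPi_of_sum_sq_eq L fun x => ?_
      rw [Fintype.sum_prod_type, Fintype.sum_prod_type]
      refine Finset.sum_congr rfl fun i _ => ?_
      have h3 : ∀ y : Fin N → ℝ, ∑ l, y l ^ 2 = y ⬝ᵥ y := fun y => by simp [dotProduct, sq]
      have h4 : ∀ j, L x (i, j) = ((fun l => x (i, l)) ᵥ* A) j := fun j => rfl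
      simp only [h4]
      rw [h3, h3 (fun l => x (i, l)), ← Matrix.dotProduct_mulVec, ← Matrix.vecMul_transpose,
        Matrix.vecMul_vecMul, hA, Matrix.vecMul_one]
    have hLm : Measurable L := L.continuous_of_finiteDimensional.measurable
    conv_rhs => rw [← hL, Measure.map_apply hLm hE]
    rfl
  have hE' : MeasurableSet {q : (Fin m × Fin N → ℝ) × Matrix (Fin N) (Fin N) ℝ | T q.2 q.1 ∈ E} :=
    hT hE
  calc _ = ∫⁻ g in {g | ∑ i, ∑ j, (rowGram g - 1) i j ^ 2 ≤ δ ^ 2},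
        μ {A | (fun p : Fin m × Fin N => √N * A (Fin.castLE hmN p.1) p.2) ∈ B} ∂Γ := by
        rw [setLIntegral_const]
    _ ≤ ∫⁻ g in {g | ∑ i, ∑ j, (rowGram g - 1) i j ^ 2 ≤ δ ^ 2}, μ {A | T A g ∈ E} ∂Γ :=
        setLIntegral_mono' hgood hfix_g
    _ ≤ ∫⁻ g, μ {A | T A g ∈ E} ∂Γ := setLIntegral_le_lintegral _ _
    _ = (Γ.prod μ) {q | T q.2 q.1 ∈ E} := (Measure.prod_apply hE').symm
    _ = ∫⁻ A, Γ {g | T A g ∈ E} ∂μ := Measure.prod_apply_symm hE'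
    _ = Γ E := by rw [lintegral_congr_ae hfix_A]; simp

section GaussianEstimates
variable {ι : Type*} [Fintype ι]

lemma iIndepFun_gaussianPi_comp {f : ℝ → ℝ} (hf : Measurable f) :
    iIndepFun (fun (i : ι) h => f (h i)) (gaussianPi ι) :=
  iIndepFun_pi (X := fun _ => f) fun _ => hf.aemeasurable

lemma integral_gaussianPi_comp {f : ℝ → ℝ} (hf : Measurable f) (i : ι) :
    ∫ h, f (h i) ∂gaussianPi ι = ∫ x, f x ∂gaussianReal 0 1 :=
  integral_comp_eval (μ := fun _ : ι => gaussianReal 0 1) hf.aestronglyMeasurable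

lemma integrable_gaussianPi_comp {f : ℝ → ℝ} (hf : Integrable f (gaussianReal 0 1)) (i : ι) :
    Integrable (fun h => f (h i)) (gaussianPi ι) :=
  (measurePreserving_eval (fun _ : ι => gaussianReal 0 1) i).integrable_comp_of_integrable hf

lemma gaussianPi_sum_deviation_le {f : ℝ → ℝ} (hf : Measurable f) (hf1 : ∀ x, |f x| ≤ 1)
    (s : Finset ι) {ε : ℝ} (hε : 0 ≤ ε) :
    (gaussianPi ι).real {h | ε * s.card ≤ |∑ i ∈ s, f (h i) - s.card * ∫ x, f x ∂gaussianReal 0 1|}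
      ≤ 2 * Real.exp (-(ε ^ 2 / 2) * s.card) := by
  set c := ∫ x, f x ∂gaussianReal 0 1
  have hsub : ∀ i : ι, HasSubgaussianMGF (fun h => f (h i) - c) 1 (gaussianPi ι) := fun i => by
    have := hasSubgaussianMGF_of_mem_Icc (μ := gaussianPi ι) (X := fun h => f (h i))
      (a := -1) (b := 1) (hf.comp (measurable_pi_apply i)).aemeasurable (ae_of_all _ fun h => abs_le.1 (hf1 _))
    rw [integral_gaussianPi_comp hf i] at this
    have h2 : ((‖(1 : ℝ) - -1‖₊ / 2) ^ 2 : NNReal) = 1 := by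
      have : ‖(1 : ℝ) - -1‖₊ = 2 := by
        ext
        norm_num
      rw [this]
      norm_num
    rwa [h2] at this
  have hind : iIndepFun (fun (i : ι) h => f (h i) - c) (gaussianPi ι) :=
    iIndepFun_gaussianPi_comp (f := fun x => f x - c) (by fun_prop)
  have hind' : iIndepFun (fun (i : ι) h => -(f (h i) - c)) (gaussianPi ι) :=
    iIndepFun_gaussianPi_comp (f := fun x => -(f x - c)) (by fun_prop)
  have hnn : 0 ≤ ε * s.card := by positivity
  have h1 := HasSubgaussianMGF.measure_sum_ge_le_of_iIndepFun hind (s := s)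
    (fun i _ => hsub i) hnn
  have h2 := HasSubgaussianMGF.measure_sum_ge_le_of_iIndepFun hind' (s := s)
    (fun i _ => (hsub i).neg) hnn
  have hexp : -(ε * s.card) ^ 2 / (2 * ∑ i ∈ s, (1 : NNReal)) = -(ε ^ 2 / 2) * s.card := by
    simp only [Finset.sum_const, nsmul_eq_mul, mul_one, NNReal.coe_natCast]
    rcases eq_or_ne (s.card : ℝ) 0 with h | h
    · simp [h]
    · field_simp
  rw [hexp] at h1 h2
  have hsplit : {h : ι → ℝ | ε * s.card ≤ |∑ i ∈ s, f (h i) - s.card * c|} ⊆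
      {h | ε * s.card ≤ ∑ i ∈ s, (f (h i) - c)} ∪ {h | ε * s.card ≤ ∑ i ∈ s, -(f (h i) - c)} := by
    intro h hh
    simp only [Set.mem_ofPred_eq, Set.mem_union, Finset.sum_neg_distrib, Finset.sum_sub_distrib,
      Finset.sum_const, nsmul_eq_mul] at hh ⊢
    exact le_abs.1 hh
  calc _ ≤ _ := measureReal_mono hsplit
    _ ≤ _ := measureReal_union_le _ _
    _ ≤ _ := by linarith

lemma exists_gaussianPi_sum_sq_le : ∃ K : ℝ, 0 < K ∧
    ∀ (ι : Type) [Fintype ι] (s : Finset ι),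
      (gaussianPi ι).real {h | K * s.card ≤ ∑ i ∈ s, h i ^ 2} ≤ Real.exp (-s.card) := by
  obtain ⟨c, hc, hint⟩ := IsGaussian.exists_integrable_exp_sq (gaussianReal 0 1)
  simp only [Real.norm_eq_abs, sq_abs] at hint
  set M := ∫ x, Real.exp (c * x ^ 2) ∂gaussianReal 0 1
  have hM : 1 ≤ M := by
    have : ∫ _, (1 : ℝ) ∂gaussianReal 0 1 ≤ M :=
      integral_mono (integrable_const _) hint fun x => Real.one_le_exp (by positivity)
    simpa using this
  have hlog := Real.log_nonneg hM
  refine ⟨(Real.log M + 1) / c, by positivity, fun ι _ s => ?_⟩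
  have hind : iIndepFun (fun (i : ι) h => h i ^ 2) (gaussianPi ι) :=
    iIndepFun_gaussianPi_comp (f := fun x => x ^ 2) (by fun_prop)
  have hmeas : ∀ i : ι, Measurable fun h : ι → ℝ => h i ^ 2 := fun i => by fun_prop
  have hmgf : ∀ i : ι, mgf (fun h => h i ^ 2) (gaussianPi ι) c = M := fun i =>
    integral_gaussianPi_comp (f := fun x => Real.exp (c * x ^ 2)) (by fun_prop) i
  have hint' : Integrable (fun h => Real.exp (c * (∑ i ∈ s, fun h : ι → ℝ => h i ^ 2) h))
      (gaussianPi ι) :=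
    hind.integrable_exp_mul_sum hmeas fun i _ =>
      integrable_gaussianPi_comp (f := fun x => Real.exp (c * x ^ 2)) hint i
  have h := measure_ge_le_exp_mul_mgf ((Real.log M + 1) / c * s.card) hc.le hint'
  rw [hind.mgf_sum hmeas, Finset.prod_congr rfl fun i _ => hmgf i, Finset.prod_const] at h
  have hMpow : M ^ s.card = Real.exp (s.card * Real.log M) := by
    rw [Real.exp_nat_mul, Real.exp_log (by linarith)]
  rw [hMpow, ← Real.exp_add] at h
  simp only [Finset.sum_apply] at h
  convert h using 2
  field_simp
  ring

lemma rowGram_sub_one_variance {m N : ℕ} (hN : 0 < N) (i j : Fin m) :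
    Integrable (fun g => (rowGram g - 1) i j ^ 2) (gaussianPi (Fin m × Fin N)) ∧
    ∫ g, (rowGram g - 1) i j ^ 2 ∂gaussianPi (Fin m × Fin N)
      ≤ (∫ x, x ^ 4 ∂gaussianReal 0 1) / N := by
  set Γ := gaussianPi (Fin m × Fin N)
  set M := ∫ x, x ^ 4 ∂gaussianReal 0 1
  let Y : Fin N → (Fin m × Fin N → ℝ) → ℝ := fun l g => g (i, l) * g (j, l)
  have h4 : Integrable (fun x : ℝ => x ^ 4) (gaussianReal 0 1) := by
    have := (memLp_id_gaussianReal (μ := 0) (v := 1) 4).integrable_norm_pow (p := 4) (by norm_num)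
    refine this.congr (ae_of_all _ fun x => ?_)
    simp [Even.pow_abs (by decide : Even 4)]
  have h4' : ∀ a, Integrable (fun g => g a ^ 4) Γ := integrable_gaussianPi_comp h4
  have hbound : ∀ l g, Y l g ^ 2 ≤ (g (i, l) ^ 4 + g (j, l) ^ 4) / 2 := fun l g => by
    simp only [Y]
    nlinarith [sq_nonneg (g (i, l) ^ 2 - g (j, l) ^ 2)]
  have hYm : ∀ l, Measurable (Y l) := fun l => by fun_prop
  have hY2 : ∀ l, Integrable (fun g => Y l g ^ 2) Γ := fun l => by
    refine (((h4' (i, l)).add (h4' (j, l))).div_const 2).mono'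
      ((hYm l).pow_const 2).aestronglyMeasurable (ae_of_all _ fun g => ?_)
    rw [Real.norm_eq_abs, abs_of_nonneg (sq_nonneg _)]
    exact hbound l g
  have hYL : ∀ l, MemLp (Y l) 2 Γ := fun l =>
    (memLp_two_iff_integrable_sq (hYm l).aestronglyMeasurable).2 (hY2 l)
  have hind : iIndepFun (fun (a : Fin m × Fin N) g => g a) Γ :=
    iIndepFun_gaussianPi_comp (f := fun x => x) measurable_id
  have hYvar : ∀ l, Var[Y l; Γ] ≤ M := fun l => by
    refine (variance_le_expectation_sq (hYm l).aestronglyMeasurable).trans ?_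
    calc _ ≤ ∫ g, (g (i, l) ^ 4 + g (j, l) ^ 4) / 2 ∂Γ :=
          integral_mono (hY2 l) (((h4' _).add (h4' _)).div_const 2) (hbound l)
      _ = M := by
          rw [integral_div, integral_add (h4' _) (h4' _),
            integral_gaussianPi_comp (f := fun x => x ^ 4) (by fun_prop),
            integral_gaussianPi_comp (f := fun x => x ^ 4) (by fun_prop)]
          ring
  have hYmean : ∀ l, ∫ g, Y l g ∂Γ = (1 : Matrix (Fin m) (Fin m) ℝ) i j := fun l => by
    rcases eq_or_ne i j with rfl | hij
    · have hv : Var[fun x : ℝ => x; gaussianReal 0 1] = 1 := by simp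
      rw [variance_eq_integral (by fun_prop)] at hv
      have := integral_gaussianPi_comp (f := fun x : ℝ => x ^ 2) (by fun_prop) (i, l)
      simp only [integral_id_gaussianReal, sub_zero] at hv
      simp only [Y, ← sq, Matrix.one_apply_eq]
      rw [← hv, ← this]
    · have hI : IndepFun (fun g => g (i, l)) (fun g => g (j, l)) Γ :=
        hind.indepFun (i := (i, l)) (j := (j, l)) (by simpa using hij)
      have h0 : ∀ a, ∫ g, g a ∂Γ = 0 := fun a => by
        rw [integral_gaussianPi_comp (f := fun x => x) measurable_id, integral_id_gaussianReal]
      rw [Matrix.one_apply_ne hij]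
      have := hI.integral_fun_mul_eq_mul_integral (measurable_pi_apply _).aestronglyMeasurable
        (measurable_pi_apply _).aestronglyMeasurable
      simpa [Y, h0] using this
  have hpair : Set.Pairwise (Finset.univ : Finset (Fin N)) fun l l' => Y l ⟂ᵢ[Γ] Y l' := by
    intro l _ l' _ hl
    exact (hind.indepFun_prodMk_prodMk (fun a => measurable_pi_apply a)
      (i, l) (j, l) (i, l') (j, l') (by simp [hl]) (by simp [hl]) (by simp [hl])
      (by simp [hl])).comp (φ := fun p : ℝ × ℝ => p.1 * p.2) (ψ := fun p : ℝ × ℝ => p.1 * p.2)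
        (by fun_prop) (by fun_prop)
  have hN' : (0 : ℝ) < N := by exact_mod_cast hN
  have hsumL : MemLp (fun g => (N : ℝ)⁻¹ * (∑ l, Y l) g) 2 Γ :=
    (memLp_finsetSum' _ fun l _ => hYL l).const_mul _
  have hrow : ∀ g : Fin m × Fin N → ℝ, (rowGram g - 1) i j
      = (N : ℝ)⁻¹ * (∑ l, Y l) g - (1 : Matrix (Fin m) (Fin m) ℝ) i j := fun g => by
    simp [rowGram, Y]
  have hmean : ∫ g, (N : ℝ)⁻¹ * (∑ l, Y l) g ∂Γ = (1 : Matrix (Fin m) (Fin m) ℝ) i j := by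
    simp only [Finset.sum_apply]
    rw [integral_const_mul, integral_finsetSum _ fun l _ => (hYL l).integrable (by norm_num)]
    simp only [hYmean, Finset.sum_const, Finset.card_univ, Fintype.card_fin, nsmul_eq_mul]
    field_simp
  simp only [hrow]
  refine ⟨(hsumL.sub (memLp_const _)).integrable_sq, ?_⟩
  have hvar := variance_eq_integral hsumL.aemeasurable
  rw [hmean] at hvar
  rw [← hvar, variance_const_mul, IndepFun.variance_sum (fun l _ => hYL l) hpair]
  calc _ ≤ (N : ℝ)⁻¹ ^ 2 * ∑ l : Fin N, M := by
        gcongr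
        exact hYvar _
    _ = M / N := by
        simp only [Finset.sum_const, Finset.card_univ, Fintype.card_fin, nsmul_eq_mul]
        field_simp

lemma half_le_gaussianPi_rowGram_near_one {m N : ℕ} (hN : 0 < N) {δ : ℝ} (hδ : 0 < δ)
    (hm : 2 * (∫ x, x ^ 4 ∂gaussianReal 0 1) * (m : ℝ) ^ 2 ≤ N * δ ^ 2) :
    1 / 2 ≤ (gaussianPi (Fin m × Fin N)).real
      {g | ∑ i, ∑ j, (rowGram g - 1) i j ^ 2 ≤ δ ^ 2} := by
  have hint : Integrable (fun g => ∑ i, ∑ j, (rowGram g - 1) i j ^ 2)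
      (gaussianPi (Fin m × Fin N)) :=
    integrable_finsetSum _ fun i _ => integrable_finsetSum _ fun j _ =>
      (rowGram_sub_one_variance hN i j).1
  have hle : ∫ g, ∑ i, ∑ j, (rowGram g - 1) i j ^ 2 ∂gaussianPi (Fin m × Fin N)
      ≤ (m : ℝ) ^ 2 * ((∫ x, x ^ 4 ∂gaussianReal 0 1) / N) := by
    rw [integral_finsetSum _ fun i _ => integrable_finsetSum _ fun j _ =>
      (rowGram_sub_one_variance hN i j).1]
    calc _ ≤ ∑ i : Fin m, ∑ j : Fin m, (∫ x, x ^ 4 ∂gaussianReal 0 1) / N := by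
          refine Finset.sum_le_sum fun i _ => ?_
          rw [integral_finsetSum _ fun j _ => (rowGram_sub_one_variance hN i j).1]
          exact Finset.sum_le_sum fun j _ => (rowGram_sub_one_variance hN i j).2
      _ = _ := by
          simp only [Finset.sum_const, Finset.card_univ, Fintype.card_fin, nsmul_eq_mul]
          ring
  have hmarkov := (mul_meas_ge_le_integral_of_nonneg (ae_of_all _ fun g =>
    Finset.sum_nonneg fun i _ => Finset.sum_nonneg fun j _ => sq_nonneg _) hint (δ ^ 2)).trans hle
  have hcompl : (gaussianPi (Fin m × Fin N)).real
        {g | ∑ i, ∑ j, (rowGram g - 1) i j ^ 2 ≤ δ ^ 2}ᶜ ≤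
      (gaussianPi (Fin m × Fin N)).real {g | δ ^ 2 ≤ ∑ i, ∑ j, (rowGram g - 1) i j ^ 2} :=
    measureReal_mono fun g hg => by
      rw [Set.mem_compl_iff, Set.mem_ofPred_eq, not_le] at hg
      exact hg.le
  have hgood : MeasurableSet {g : Fin m × Fin N → ℝ | ∑ i, ∑ j, (rowGram g - 1) i j ^ 2 ≤ δ ^ 2} :=
    measurable_rowGram_error measurableSet_Iic
  rw [probReal_compl_eq_one_sub hgood] at hcompl
  have hN' : (0 : ℝ) < N := by exact_mod_cast hN
  have hδ2 : 0 < δ ^ 2 := by positivity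
  have : (m : ℝ) ^ 2 * ((∫ x, x ^ 4 ∂gaussianReal 0 1) / N) ≤ δ ^ 2 / 2 := by
    rw [mul_div_assoc', div_le_iff₀ hN']
    linarith
  have h2 := le_of_mul_le_mul_left (hmarkov.trans (this.trans_eq (div_eq_mul_one_div _ _))) hδ2
  linarith

end GaussianEstimates

/-- The sum of `f` over the rescaled entries of the upper left `m × k` block of `A`. -/
noncomputable def blockSum (f : ℝ → ℝ) (m k : ℕ) {N : ℕ} (A : Matrix (Fin N) (Fin N) ℝ) : ℝ :=
  ∑ i ∈ Finset.range m, ∑ j ∈ Finset.range k, f (√N * entryOrZero A i j)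

lemma blockSum_transpose (f : ℝ → ℝ) (m k : ℕ) {N : ℕ} (A : Matrix (Fin N) (Fin N) ℝ) :
    blockSum f k m Aᵀ = blockSum f m k A := by
  have : ∀ i j, entryOrZero Aᵀ i j = entryOrZero A j i := fun i j => by
    simp [entryOrZero, and_comm]
  simp only [blockSum, this]
  exact Finset.sum_comm

lemma measurable_blockSum {f : ℝ → ℝ} (hf : Measurable f) (m k : ℕ) {N : ℕ} :
    Measurable (blockSum f m k : Matrix (Fin N) (Fin N) ℝ → ℝ) := by
  refine Finset.measurable_sum _ fun i _ => Finset.measurable_sum _ fun j _ =>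
    hf.comp (measurable_const.mul ?_)
  unfold entryOrZero
  split_ifs with h
  · exact measurable_matrix_entry _ _
  · exact measurable_const

section Block
variable {m k N : ℕ}

/-- The first `k` columns of an `m × N` array. -/
def firstColumns (m : ℕ) (hkN : k ≤ N) : Finset (Fin m × Fin N) :=
  Finset.univ ×ˢ Finset.univ.map (Fin.castLEEmb hkN)

lemma card_firstColumns (hkN : k ≤ N) : (firstColumns m hkN).card = m * k := by
  simp [firstColumns, Finset.card_product]

lemma blockSum_eq_sum_firstColumns (f : ℝ → ℝ) (hmN : m ≤ N) (hkN : k ≤ N)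
    (A : Matrix (Fin N) (Fin N) ℝ) :
    blockSum f m k A = ∑ p ∈ firstColumns m hkN, f (√N * A (Fin.castLE hmN p.1) p.2) := by
  rw [firstColumns, Finset.sum_product, blockSum, Finset.sum_range]
  refine Finset.sum_congr rfl fun i _ => ?_
  rw [Finset.sum_range, Finset.sum_map]
  refine Finset.sum_congr rfl fun j _ => ?_
  have : (i : ℕ) < N ∧ (j : ℕ) < N := ⟨i.2.trans_le hmN, j.2.trans_le hkN⟩
  simp only [entryOrZero, this, and_self, dif_pos]
  rfl

lemma sum_firstColumns_sub_mulVec_sq_le (hkN : k ≤ N) {S : Matrix (Fin m) (Fin m) ℝ} {δ : ℝ}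
    (hS : ∀ v, ∑ i, (v i - (S *ᵥ v) i) ^ 2 ≤ δ ^ 2 * ∑ i, v i ^ 2) (h : Fin m × Fin N → ℝ) :
    ∑ p ∈ firstColumns m hkN, (h p - (S *ᵥ fun i => h (i, p.2)) p.1) ^ 2
      ≤ δ ^ 2 * ∑ p ∈ firstColumns m hkN, h p ^ 2 := by
  rw [firstColumns, Finset.sum_product_right, Finset.sum_product_right, Finset.mul_sum]
  exact Finset.sum_le_sum fun l _ => hS fun i => h (i, l)

lemma orthogonal_block_real_le (hmN : m ≤ N) (hN : 0 < N)
    {μ : Measure (Matrix (Fin N) (Fin N) ℝ)}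
    [IsProbabilityMeasure μ] (hμ : μ {A | A * Aᵀ = 1} = 1)
    (hinv : ∀ B : Matrix (Fin N) (Fin N) ℝ, B * Bᵀ = 1 → μ.map (fun A => B * A) = μ)
    {δ : ℝ} (hδ0 : 0 < δ) (hδ : δ ≤ 1 / 2)
    (hm : 2 * (∫ x, x ^ 4 ∂gaussianReal 0 1) * (m : ℝ) ^ 2 ≤ N * δ ^ 2)
    {B E : Set (Fin m × Fin N → ℝ)}
    (hB : MeasurableSet B) (hE : MeasurableSet E)
    (hBE : ∀ S : Matrix (Fin m) (Fin m) ℝ,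
      (∀ v, ∑ i, (v i - (S *ᵥ v) i) ^ 2 ≤ δ ^ 2 * ∑ i, v i ^ 2) →
      ∀ h ∉ E, (fun p => (S *ᵥ fun i => h (i, p.2)) p.1) ∉ B) :
    μ.real {A | (fun p : Fin m × Fin N => √N * A (Fin.castLE hmN p.1) p.2) ∈ B} ≤
      2 * (gaussianPi (Fin m × Fin N)).real E := by
  have h1 := ENNReal.toReal_mono (measure_ne_top _ _)
    (orthogonal_block_mul_gaussian_le hmN hN hμ hinv hδ0.le hδ hB hE hBE)
  rw [ENNReal.toReal_mul] at h1
  have h2 := half_le_gaussianPi_rowGram_near_one hN hδ0 hm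
  simp only [measureReal_def] at h2 ⊢
  nlinarith [ENNReal.toReal_nonneg
    (a := μ {A | (fun p : Fin m × Fin N => √N * A (Fin.castLE hmN p.1) p.2) ∈ B})]

end Block

lemma exists_orthogonal_blockSum_deviation_le {f : ℝ → ℝ} (hf : Measurable f)
    (hf1 : ∀ x, |f x| ≤ 1) {L : ℝ} (hfL : ∀ x y, |f x - f y| ≤ L * |x - y|)
    {ε : ℝ} (hε : 0 < ε) :
    ∃ c > 0, ∃ η > 0, ∀ (m k N : ℕ), m ≤ N → k ≤ N → 0 < N → (m : ℝ) ^ 2 ≤ η * N →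
      ∀ (μ : Measure (Matrix (Fin N) (Fin N) ℝ)) [IsProbabilityMeasure μ],
      μ {A | A * Aᵀ = 1} = 1 →
      (∀ B : Matrix (Fin N) (Fin N) ℝ, B * Bᵀ = 1 → μ.map (fun A => B * A) = μ) →
      μ.real {A | ε * (m * k : ℕ) ≤
        |blockSum f m k A - (m * k : ℕ) * ∫ x, f x ∂gaussianReal 0 1|}
        ≤ 6 * Real.exp (-c * (m * k : ℕ)) := by
  obtain ⟨K, hK, hKE⟩ := exists_gaussianPi_sum_sq_le
  set M := ∫ x, x ^ 4 ∂gaussianReal 0 1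
  have hM : 0 ≤ M := integral_nonneg fun x => by positivity
  obtain ⟨δ, hδ0, hδ, hLδ⟩ : ∃ δ : ℝ, 0 < δ ∧ δ ≤ 1 / 2 ∧ L ^ 2 * δ ^ 2 * K ≤ (ε / 2) ^ 2 := by
    have ht : Tendsto (fun δ : ℝ => L ^ 2 * δ ^ 2 * K) (nhdsWithin 0 (Set.Ioi 0)) (nhds 0) := by
      have : Continuous fun δ : ℝ => L ^ 2 * δ ^ 2 * K := by fun_prop
      simpa using (this.tendsto 0).mono_left nhdsWithin_le_nhds
    have h1 := ht.eventually_le_const (by positivity : 0 < (ε / 2) ^ 2)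
    have h2 : ∀ᶠ δ : ℝ in nhdsWithin 0 (Set.Ioi 0), δ ∈ Set.Ioc (0 : ℝ) (1 / 2) :=
      Ioc_mem_nhdsGT (by norm_num)
    obtain ⟨δ, h3, h4⟩ := (h1.and h2).exists
    exact ⟨δ, h4.1, h4.2, h3⟩
  refine ⟨min ((ε / 2) ^ 2 / 2) 1, by positivity, δ ^ 2 / (2 * M + 1), by positivity,
    fun m k N hmN hkN hN hm μ _ hμ hinv => ?_⟩
  have hm' : 2 * M * (m : ℝ) ^ 2 ≤ N * δ ^ 2 := by
    have : (m : ℝ) ^ 2 * (2 * M + 1) ≤ δ ^ 2 * N := by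
      rwa [div_mul_eq_mul_div, le_div_iff₀ (by positivity)] at hm
    nlinarith [sq_nonneg (m : ℝ)]
  set c := ∫ x, f x ∂gaussianReal 0 1
  set s := firstColumns m hkN
  have hs : s.card = m * k := card_firstColumns hkN
  let D : ℝ → Set (Fin m × Fin N → ℝ) := fun ε => {h | ε * s.card ≤ |∑ p ∈ s, f (h p) - s.card * c|}
  have hDm : ∀ ε, MeasurableSet (D ε) := fun ε => by
    refine measurableSet_le measurable_const (Measurable.abs (Measurable.sub ?_ measurable_const))
    exact Finset.measurable_sum _ fun p _ => hf.comp (measurable_pi_apply p)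
  let E : Set (Fin m × Fin N → ℝ) := {h | K * s.card ≤ ∑ p ∈ s, h p ^ 2}
  have hEm : MeasurableSet E := measurableSet_le measurable_const (by fun_prop)
  have key := orthogonal_block_real_le hmN hN hμ hinv hδ0 hδ hm' (hDm ε)
    ((hDm (ε / 2)).union hEm) (fun S hS h hh => by
      simp only [Set.mem_union, not_or, D, E, Set.mem_ofPred_eq, not_le] at hh ⊢
      obtain ⟨h1, h2⟩ := hh
      have h3 := sum_firstColumns_sub_mulVec_sq_le hkN hS h
      set h' : Fin m × Fin N → ℝ := fun p => (S *ᵥ fun i => h (i, p.2)) p.1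
      have h4 : |∑ p ∈ s, f (h p) - ∑ p ∈ s, f (h' p)| ≤ L * ∑ p ∈ s, |h p - h' p| := by
        rw [← Finset.sum_sub_distrib, Finset.mul_sum]
        exact (Finset.abs_sum_le_sum_abs _ _).trans (Finset.sum_le_sum fun p _ => hfL _ _)
      have h5 : (∑ p ∈ s, |h p - h' p|) ^ 2 ≤ s.card * ∑ p ∈ s, (h p - h' p) ^ 2 := by
        simpa using sq_sum_le_card_mul_sum_sq (s := s) (f := fun p => |h p - h' p|)
      have h6 : L * ∑ p ∈ s, |h p - h' p| ≤ ε / 2 * s.card := by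
        refine le_of_sq_le_sq ?_ (by positivity)
        calc _ = L ^ 2 * (∑ p ∈ s, |h p - h' p|) ^ 2 := by ring
          _ ≤ L ^ 2 * (s.card * (δ ^ 2 * (K * s.card))) := by
              gcongr
              refine h5.trans ?_
              gcongr
              exact h3.trans (by gcongr)
          _ = L ^ 2 * δ ^ 2 * K * (s.card : ℝ) ^ 2 := by ring
          _ ≤ (ε / 2) ^ 2 * (s.card : ℝ) ^ 2 := by gcongr
          _ = _ := by ring
      have h7 := abs_sub_abs_le_abs_sub (∑ p ∈ s, f (h' p) - s.card * c)
        (∑ p ∈ s, f (h p) - s.card * c)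
      rw [sub_sub_sub_cancel_right,
        abs_sub_comm (∑ p ∈ s, f (h' p)) (∑ p ∈ s, f (h p))] at h7
      change |∑ p ∈ s, f (h' p) - s.card * c| < ε * s.card
      linarith)
  have hset : {A : Matrix (Fin N) (Fin N) ℝ |
      ε * (m * k : ℕ) ≤ |blockSum f m k A - (m * k : ℕ) * c|} =
      {A | (fun p : Fin m × Fin N => √N * A (Fin.castLE hmN p.1) p.2) ∈ D ε} := by
    ext A
    simp only [Set.mem_ofPred_eq, D, blockSum_eq_sum_firstColumns f hmN hkN, hs, s]
  rw [hset]
  have hD := gaussianPi_sum_deviation_le hf hf1 s (by positivity : 0 ≤ ε / 2)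
  have hE := hKE _ s
  have hU := measureReal_union_le (μ := gaussianPi (Fin m × Fin N)) (D (ε / 2)) E
  have hexp1 : Real.exp (-((ε / 2) ^ 2 / 2) * s.card) ≤
      Real.exp (-min ((ε / 2) ^ 2 / 2) 1 * s.card) := by
    gcongr
    exact min_le_left _ _
  have hexp2 : Real.exp (-s.card) ≤ Real.exp (-min ((ε / 2) ^ 2 / 2) 1 * s.card) := by
    rw [← neg_one_mul]
    gcongr
    exact min_le_right _ _
  rw [← hs]
  linarith

lemma exists_orthogonal_blockSum_sq_le :
    ∃ K > 0, ∃ η > 0, ∀ (m k N : ℕ), m ≤ N → k ≤ N → 0 < N → (m : ℝ) ^ 2 ≤ η * N →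
      ∀ (μ : Measure (Matrix (Fin N) (Fin N) ℝ)) [IsProbabilityMeasure μ],
      μ {A | A * Aᵀ = 1} = 1 →
      (∀ B : Matrix (Fin N) (Fin N) ℝ, B * Bᵀ = 1 → μ.map (fun A => B * A) = μ) →
      μ.real {A | K * (m * k : ℕ) ≤ blockSum (fun x => x ^ 2) m k A}
        ≤ 6 * Real.exp (-1 * (m * k : ℕ)) := by
  obtain ⟨K, hK, hKE⟩ := exists_gaussianPi_sum_sq_le
  set M := ∫ x, x ^ 4 ∂gaussianReal 0 1
  have hM : 0 ≤ M := integral_nonneg fun x => by positivity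
  refine ⟨4 * K, by positivity, (1 / 2) ^ 2 / (2 * M + 1), by positivity,
    fun m k N hmN hkN hN hm μ _ hμ hinv => ?_⟩
  have hm' : 2 * M * (m : ℝ) ^ 2 ≤ N * (1 / 2) ^ 2 := by
    have : (m : ℝ) ^ 2 * (2 * M + 1) ≤ (1 / 2) ^ 2 * N := by
      rwa [div_mul_eq_mul_div, le_div_iff₀ (by positivity)] at hm
    nlinarith [sq_nonneg (m : ℝ)]
  set s := firstColumns m hkN
  have hs : s.card = m * k := card_firstColumns hkN
  let E : ℝ → Set (Fin m × Fin N → ℝ) := fun K => {h | K * s.card ≤ ∑ p ∈ s, h p ^ 2}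
  have hEm : ∀ K, MeasurableSet (E K) := fun K => measurableSet_le measurable_const (by fun_prop)
  have key := orthogonal_block_real_le hmN hN hμ hinv (by norm_num) le_rfl hm' (hEm (4 * K))
    (hEm K) (fun S hS h hh => by
      simp only [E, Set.mem_ofPred_eq, not_le] at hh ⊢
      have h3 := sum_firstColumns_sub_mulVec_sq_le hkN hS h
      set h' : Fin m × Fin N → ℝ := fun p => (S *ᵥ fun i => h (i, p.2)) p.1
      have h4 : ∑ p ∈ s, h' p ^ 2 ≤ 2 * ∑ p ∈ s, h p ^ 2 + 2 * ∑ p ∈ s, (h p - h' p) ^ 2 := by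
        rw [Finset.mul_sum, Finset.mul_sum, ← Finset.sum_add_distrib]
        refine Finset.sum_le_sum fun p _ => ?_
        nlinarith [sq_nonneg (2 * h p - h' p)]
      have h5 : (0 : ℝ) ≤ K * s.card := by positivity
      linarith)
  have hset : {A : Matrix (Fin N) (Fin N) ℝ |
      4 * K * (m * k : ℕ) ≤ blockSum (fun x => x ^ 2) m k A} =
      {A | (fun p : Fin m × Fin N => √N * A (Fin.castLE hmN p.1) p.2) ∈ E (4 * K)} := by
    ext A
    simp only [Set.mem_ofPred_eq, E, blockSum_eq_sum_firstColumns _ hmN hkN, hs, s]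
  rw [hset, ← hs, neg_one_mul]
  have hE := hKE _ s
  have := Real.exp_pos (-(s.card : ℝ))
  linarith

section EmpiricalMeasure
variable {m k N : ℕ}

lemma isProbabilityMeasure_empMeas (hmk : 0 < m * k) (A : Matrix (Fin N) (Fin N) ℝ) :
    IsProbabilityMeasure (empMeas m k N A) := by
  constructor
  simp only [empMeas, Measure.smul_apply, Measure.coe_finsetSum, Finset.sum_apply, measure_univ,
    Finset.sum_const, Finset.card_range, nsmul_eq_mul, mul_one, smul_eq_mul, ← Nat.cast_mul]
  exact ENNReal.inv_mul_cancel (by exact_mod_cast hmk.ne') (ENNReal.natCast_ne_top _)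

lemma coe_empPM (hmk : 0 < m * k) (A : Matrix (Fin N) (Fin N) ℝ) :
    (empPM m k N A : Measure ℝ) = empMeas m k N A := by
  have h : empPM m k N A = ⟨empMeas m k N A, isProbabilityMeasure_empMeas hmk A⟩ := dif_pos _
  rw [h]
  rfl

lemma charFun_empMeas (A : Matrix (Fin N) (Fin N) ℝ) (t : ℝ) :
    charFun (empMeas m k N A) t =
      (blockSum (fun x => Real.cos (t * x)) m k A / (m * k : ℕ) : ℝ) +
        (blockSum (fun x => Real.sin (t * x)) m k A / (m * k : ℕ) : ℝ) * Complex.I := by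
  have hint : ∀ a : ℝ, Integrable (fun x : ℝ => Complex.exp (t * x * Complex.I))
      (Measure.dirac a) := fun a => integrable_dirac (by simp)
  rw [charFun_apply_real, empMeas, integral_smul_measure, integral_finsetSum_measure
    fun i _ => integrable_finsetSum_measure.2 fun j _ => hint _]
  simp_rw [integral_finsetSum_measure fun j _ => hint _, integral_dirac]
  have hexp : ∀ a : ℝ, Complex.exp (t * a * Complex.I) =
      (Real.cos (t * a) : ℝ) + (Real.sin (t * a) : ℝ) * Complex.I := fun a => by
    rw [← Complex.ofReal_mul, Complex.exp_mul_I, Complex.ofReal_cos, Complex.ofReal_sin]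
  simp_rw [hexp, Finset.sum_add_distrib, ← Finset.sum_mul, blockSum]
  simp only [ENNReal.toReal_inv, ENNReal.toReal_natCast, Complex.real_smul, Complex.ofReal_inv,
    Complex.ofReal_natCast, Complex.ofReal_div, Complex.ofReal_sum]
  ring

lemma abs_blockSum_sub_le {g : ℝ → ℝ} (hg : ∀ x y, |g x - g y| ≤ |x - y|) (s t : ℝ)
    (A : Matrix (Fin N) (Fin N) ℝ) :
    |blockSum (fun x => g (s * x)) m k A - blockSum (fun x => g (t * x)) m k A| ≤
      |s - t| * ((m * k : ℕ) + blockSum (fun x => x ^ 2) m k A) := by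
  simp only [blockSum, ← Finset.sum_sub_distrib]
  calc _ ≤ ∑ i ∈ Finset.range m, ∑ j ∈ Finset.range k,
        |s - t| * (1 + (√N * entryOrZero A i j) ^ 2) := by
        refine (Finset.abs_sum_le_sum_abs _ _).trans (Finset.sum_le_sum fun i _ =>
          (Finset.abs_sum_le_sum_abs _ _).trans (Finset.sum_le_sum fun j _ => ?_))
        refine (hg _ _).trans ?_
        rw [← sub_mul, abs_mul]
        gcongr
        rw [← sq_abs]
        nlinarith [sq_nonneg (|√N * entryOrZero A i j| - 1), abs_nonneg (√N * entryOrZero A i j)]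
    _ = _ := by
        simp only [← Finset.mul_sum, Finset.sum_add_distrib, Finset.sum_const, Finset.card_range,
          nsmul_eq_mul, mul_one, Nat.cast_mul]

end EmpiricalMeasure

lemma continuous_integral_comp_mul (ν : Measure ℝ) [IsFiniteMeasure ν] {g : ℝ → ℝ}
    (hg : Continuous g) (hg1 : ∀ x, |g x| ≤ 1) : Continuous fun t => ∫ x, g (t * x) ∂ν :=
  continuous_of_dominated (bound := fun _ => 1)
    (fun _ => (hg.comp (continuous_const.mul continuous_id)).aestronglyMeasurable)
    (fun _ => ae_of_all _ fun _ => hg1 _) (integrable_const _)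
    (ae_of_all _ fun _ => hg.comp (continuous_id.mul continuous_const))

lemma tendsto_blockSum_comp_mul_of_rat {m k : ℕ → ℕ} {A : (N : ℕ) → Matrix (Fin N) (Fin N) ℝ}
    (hmk : ∀ᶠ N in atTop, 0 < m N * k N) {K : ℝ}
    (hK : ∀ᶠ N in atTop, blockSum (fun x => x ^ 2) (m N) (k N) (A N) ≤ K * (m N * k N : ℕ))
    {g : ℝ → ℝ} (hg : ∀ x y, |g x - g y| ≤ |x - y|) {G : ℝ → ℝ} (hG : Continuous G)
    (hq : ∀ q : ℚ, Tendsto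
      (fun N => blockSum (fun x => g (q * x)) (m N) (k N) (A N) / (m N * k N : ℕ))
      atTop (nhds (G q))) (t : ℝ) :
    Tendsto (fun N => blockSum (fun x => g (t * x)) (m N) (k N) (A N) / (m N * k N : ℕ))
      atTop (nhds (G t)) := by
  rw [Metric.tendsto_nhds]
  intro ε hε
  have hcont : Continuous fun s => |t - s| * (1 + K) + |G s - G t| := by fun_prop
  obtain ⟨q, hqt⟩ := (Rat.isDenseEmbedding_coe_real.dense).exists_mem_open
    (isOpen_lt hcont (continuous_const (y := ε / 2))) ⟨t, by simpa using half_pos hε⟩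
  filter_upwards [hmk, hK, (Metric.tendsto_nhds.1 (hq q)) (ε / 2) (half_pos hε)] with N h1 h2 h3
  rw [Set.mem_ofPred_eq] at hqt
  rw [Real.dist_eq] at h3 ⊢
  have hpos : (0 : ℝ) < (m N * k N : ℕ) := by exact_mod_cast h1
  have h4 : |blockSum (fun x => g (t * x)) (m N) (k N) (A N) / (m N * k N : ℕ) -
      blockSum (fun x => g (q * x)) (m N) (k N) (A N) / (m N * k N : ℕ)| ≤ |t - q| * (1 + K) := by
    rw [← sub_div, abs_div, abs_of_pos hpos, div_le_iff₀ hpos]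
    refine (abs_blockSum_sub_le hg t q (A N)).trans ?_
    rw [mul_assoc]
    gcongr
    linarith
  have h5 := abs_sub_le (blockSum (fun x => g (t * x)) (m N) (k N) (A N) / (m N * k N : ℕ))
    (blockSum (fun x => g (q * x)) (m N) (k N) (A N) / (m N * k N : ℕ)) (G t)
  have h6 := abs_sub_le (blockSum (fun x => g (q * x)) (m N) (k N) (A N) / (m N * k N : ℕ))
    (G q) (G t)
  linarith

lemma abs_cos_sub_cos_le (x y : ℝ) : |Real.cos x - Real.cos y| ≤ |x - y| := by
  simpa [Real.dist_eq] using Real.lipschitzWith_cos.dist_le_mul x y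

lemma abs_sin_sub_sin_le (x y : ℝ) : |Real.sin x - Real.sin y| ≤ |x - y| := by
  simpa [Real.dist_eq] using Real.lipschitzWith_sin.dist_le_mul x y

lemma charFun_eq_integral_cos_add_sin (ν : Measure ℝ) [IsProbabilityMeasure ν] (t : ℝ) :
    charFun ν t = (∫ x, Real.cos (t * x) ∂ν : ℝ) + (∫ x, Real.sin (t * x) ∂ν : ℝ) * Complex.I := by
  have hcos : Integrable (fun x : ℝ => (Real.cos (t * x) : ℂ)) ν :=
    .of_bound (by fun_prop) 1 (ae_of_all _ fun x => by
      simpa only [Complex.norm_real, Real.norm_eq_abs] using Real.abs_cos_le_one _)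
  have hsin : Integrable (fun x : ℝ => (Real.sin (t * x) : ℂ)) ν :=
    .of_bound (by fun_prop) 1 (ae_of_all _ fun x => by
      simpa only [Complex.norm_real, Real.norm_eq_abs] using Real.abs_sin_le_one _)
  rw [charFun_apply_real, ← integral_complex_ofReal, ← integral_complex_ofReal,
    ← integral_mul_const, ← integral_add hcos (hsin.mul_const _)]
  refine integral_congr_ae (ae_of_all _ fun x => ?_)
  simp only
  rw [← Complex.ofReal_mul, Complex.exp_mul_I, Complex.ofReal_cos, Complex.ofReal_sin]

lemma tendsto_empPM_of_blockSum {m k : ℕ → ℕ} {A : (N : ℕ) → Matrix (Fin N) (Fin N) ℝ}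
    (ν : ProbabilityMeasure ℝ) (hmk : ∀ᶠ N in atTop, 0 < m N * k N) {K : ℝ}
    (hK : ∀ᶠ N in atTop, blockSum (fun x => x ^ 2) (m N) (k N) (A N) ≤ K * (m N * k N : ℕ))
    (hcos : ∀ q : ℚ, Tendsto
      (fun N => blockSum (fun x => Real.cos (q * x)) (m N) (k N) (A N) / (m N * k N : ℕ))
      atTop (nhds (∫ x, Real.cos (q * x) ∂ν)))
    (hsin : ∀ q : ℚ, Tendsto
      (fun N => blockSum (fun x => Real.sin (q * x)) (m N) (k N) (A N) / (m N * k N : ℕ))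
      atTop (nhds (∫ x, Real.sin (q * x) ∂ν))) :
    Tendsto (fun N => empPM (m N) (k N) N (A N)) atTop (nhds ν) := by
  rw [ProbabilityMeasure.tendsto_iff_tendsto_charFun]
  intro t
  have h1 := tendsto_blockSum_comp_mul_of_rat hmk hK abs_cos_sub_cos_le
    (continuous_integral_comp_mul ν Real.continuous_cos Real.abs_cos_le_one) hcos t
  have h2 := tendsto_blockSum_comp_mul_of_rat hmk hK abs_sin_sub_sin_le
    (continuous_integral_comp_mul ν Real.continuous_sin Real.abs_sin_le_one) hsin t
  rw [charFun_eq_integral_cos_add_sin]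
  refine (((Complex.continuous_ofReal.tendsto _).comp h1).add
    (((Complex.continuous_ofReal.tendsto _).comp h2).mul_const Complex.I)).congr' ?_
  filter_upwards [hmk] with N hN
  rw [coe_empPM hN, charFun_empMeas]
  rfl

section PowerSize
variable {α : ℝ}

lemma eventually_floor_rpow_le_mul (hα : α < 1) {η : ℝ} (hη : 0 < η) :
    ∀ᶠ N : ℕ in atTop, (⌊(N : ℝ) ^ α⌋₊ : ℝ) ≤ η * N := by
  have h := (tendsto_rpow_neg_atTop (sub_pos.2 hα)).comp (tendsto_natCast_atTop_atTop (R := ℝ))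
  filter_upwards [h.eventually_le_const hη, eventually_gt_atTop 0] with N hN hN0
  have hpos : (0 : ℝ) < N := by exact_mod_cast hN0
  refine (Nat.floor_le (by positivity)).trans ?_
  rwa [Function.comp_apply, neg_sub, Real.rpow_sub_one hpos.ne', div_le_iff₀ hpos] at hN

lemma summable_exp_neg_mul_floor_rpow (hα : 0 < α) {c : ℝ} (hc : 0 < c) :
    Summable fun N : ℕ => Real.exp (-c * (⌊(N : ℝ) ^ α⌋₊ : ℕ)) := by
  have h := ((isLittleO_exp_neg_mul_rpow_atTop hc (-2 / α)).comp_tendsto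
    ((tendsto_rpow_atTop hα).comp tendsto_natCast_atTop_atTop)).isBigO
  have hs : Summable fun N : ℕ => ((N : ℝ) ^ α) ^ (-2 / α) := by
    have : ∀ N : ℕ, ((N : ℝ) ^ α) ^ (-2 / α) = (N : ℝ) ^ (-2 : ℝ) := fun N => by
      rw [← Real.rpow_mul (Nat.cast_nonneg N), mul_div_cancel₀ _ hα.ne']
    simp_rw [this]
    exact Real.summable_nat_rpow.2 (by norm_num)
  refine Summable.of_nonneg_of_le (fun N => (Real.exp_pos _).le) (fun N => ?_)
    ((summable_of_isBigO_nat hs h).mul_left (Real.exp c))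
  simp only [Function.comp_apply]
  rw [← Real.exp_add, Real.exp_le_exp]
  nlinarith [Nat.lt_floor_add_one ((N : ℝ) ^ α)]

lemma ae_eventually_blockSum_notMem (hα : α ∈ Set.Ioo (0 : ℝ) 1) {m k : ℕ → ℕ}
    (hp : ∀ N, m N * k N = ⌊(N : ℝ) ^ α⌋₊)
    {μ : (N : ℕ) → Measure (Matrix (Fin N) (Fin N) ℝ)} (hμ_prob : ∀ N, IsProbabilityMeasure (μ N))
    (hμ_supp : ∀ N, μ N {A | A * Aᵀ = 1} = 1)
    (hμ_inv : ∀ N (B : Matrix (Fin N) (Fin N) ℝ), B * Bᵀ = 1 →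
      (μ N).map (fun A => B * A) = μ N)
    {Ω : Type*} [MeasurableSpace Ω] {P : Measure Ω}
    {X : (N : ℕ) → Ω → Matrix (Fin N) (Fin N) ℝ} (hX_meas : ∀ N, Measurable (X N))
    (hX_law : ∀ N, P.map (X N) = μ N)
    {f : ℝ → ℝ} (hf : Measurable f) {T : ℕ → Set ℝ} (hT : ∀ p, MeasurableSet (T p))
    {c : ℝ} (hc : 0 < c) {η : ℝ} (hη : 0 < η)
    (hbound : ∀ (m k N : ℕ), m ≤ N → k ≤ N → 0 < N → (m : ℝ) ^ 2 ≤ η * N →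
      ∀ (μ : Measure (Matrix (Fin N) (Fin N) ℝ)) [IsProbabilityMeasure μ],
      μ {A | A * Aᵀ = 1} = 1 →
      (∀ B : Matrix (Fin N) (Fin N) ℝ, B * Bᵀ = 1 → μ.map (fun A => B * A) = μ) →
      μ.real {A | blockSum f m k A ∈ T (m * k)} ≤ 6 * Real.exp (-c * (m * k : ℕ))) :
    ∀ᵐ ω ∂P, ∀ᶠ N in atTop, blockSum f (m N) (k N) (X N ω) ∉ T (m N * k N) := by
  have hmeas : ∀ (m k p N : ℕ), MeasurableSet
      {A : Matrix (Fin N) (Fin N) ℝ | blockSum f m k A ∈ T p} :=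
    fun m k p N => measurable_blockSum hf m k (hT p)
  have hev : ∀ᶠ N in atTop, (μ N).real {A | blockSum f (m N) (k N) A ∈ T (m N * k N)} ≤
      6 * Real.exp (-c * (⌊(N : ℝ) ^ α⌋₊ : ℕ)) := by
    filter_upwards [eventually_floor_rpow_le_mul hα.2 hη, eventually_ge_atTop 1] with N hN hN1
    have hmk1 : 1 ≤ m N * k N := by
      rw [hp]
      exact Nat.one_le_floor_iff _ |>.2 (Real.one_le_rpow (by exact_mod_cast hN1) hα.1.le)
    have hmkN : m N * k N ≤ N := by
      rw [hp]
      refine Nat.floor_le_of_le ?_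
      simpa using Real.rpow_le_rpow_of_exponent_le (x := N) (by exact_mod_cast hN1) hα.2.le
    have hm1 : 0 < m N := Nat.pos_of_mul_pos_right hmk1
    have hk1 : 0 < k N := Nat.pos_of_mul_pos_left hmk1
    have hmN : m N ≤ N := (Nat.le_mul_of_pos_right _ hk1).trans hmkN
    have hkN : k N ≤ N := (Nat.le_mul_of_pos_left _ hm1).trans hmkN
    rw [← hp] at hN ⊢
    rcases le_total (m N) (k N) with hle | hle
    · refine hbound _ _ N hmN hkN hN1 (le_trans ?_ hN) (μ N) (hμ_supp N) (hμ_inv N)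
      rw [sq]
      exact_mod_cast Nat.mul_le_mul_left _ hle
    · have h := hbound (k N) (m N) N hkN hmN hN1 (le_trans (by
        rw [sq]
        exact_mod_cast Nat.mul_le_mul_right _ hle) hN) (μ N) (hμ_supp N) (hμ_inv N)
      rw [← map_transpose_eq_of_left_invariant (hμ_supp N) (hμ_inv N),
        map_measureReal_apply measurable_matrix_transpose (hmeas _ _ _ _)] at h
      simpa only [Set.preimage_ofPred_eq, blockSum_transpose, mul_comm (k N)] using h
  have hprob : ∀ N, P {ω | blockSum f (m N) (k N) (X N ω) ∈ T (m N * k N)} =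
      ENNReal.ofReal ((μ N).real {A | blockSum f (m N) (k N) A ∈ T (m N * k N)}) := fun N => by
    rw [ofReal_measureReal, ← hX_law, Measure.map_apply (hX_meas N) (hmeas _ _ _ _)]
    rfl
  have hsum : Summable fun N => (μ N).real {A | blockSum f (m N) (k N) A ∈ T (m N * k N)} := by
    refine ((summable_exp_neg_mul_floor_rpow hα.1 hc).mul_left 6).of_norm_bounded_eventually_nat ?_
    filter_upwards [hev] with N hN
    rwa [Real.norm_of_nonneg measureReal_nonneg]
  refine ae_eventually_notMem (s := fun N => {ω | blockSum f (m N) (k N) (X N ω) ∈ T (m N * k N)}) ?_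
  simp_rw [hprob]
  exact hsum.tsum_ofReal_ne_top

end PowerSize

/-- **Almost sure weak convergence of the empirical measures to the standard Gaussian.**
Here `μ N` is the Haar probability measure on `O(N)` (a probability measure on `N × N`
matrices, concentrated on orthogonal matrices and invariant under left multiplication by
orthogonal matrices), and the random matrices `X N` are realized on a common probability
space `(Ω, P)` with `X N` distributed according to `μ N`. -/
theorem stmt_2
    (α : ℝ) (hα : α ∈ Set.Ioo (0 : ℝ) 1)
    (m k : ℕ → ℕ)
    (hp : ∀ N, m N * k N = ⌊(N : ℝ) ^ α⌋₊)
    (μ : (N : ℕ) → Measure (Matrix (Fin N) (Fin N) ℝ))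
    (hμ_prob : ∀ N, IsProbabilityMeasure (μ N))
    (hμ_supp : ∀ N, μ N {A | A * Aᵀ = 1} = 1)
    (hμ_inv : ∀ N (B : Matrix (Fin N) (Fin N) ℝ), B * Bᵀ = 1 →
      (μ N).map (fun A => B * A) = μ N)
    (Ω : Type*) [MeasurableSpace Ω] (P : Measure Ω) [IsProbabilityMeasure P]
    (X : (N : ℕ) → Ω → Matrix (Fin N) (Fin N) ℝ)
    (hX_meas : ∀ N, Measurable (X N))
    (hX_law : ∀ N, P.map (X N) = μ N) :
    ∀ᵐ ω ∂P,
      Tendsto (fun N => empPM (m N) (k N) N (X N ω)) atTop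
        (nhds (⟨gaussianReal 0 1, inferInstance⟩ : ProbabilityMeasure ℝ)) := by
  have hmk : ∀ᶠ N in atTop, 0 < m N * k N := by
    filter_upwards [eventually_ge_atTop 1] with N hN
    rw [hp]
    exact Nat.one_le_floor_iff _ |>.2 (Real.one_le_rpow (by exact_mod_cast hN) hα.1.le)
  have key : ∀ {f : ℝ → ℝ} {L : ℝ}, Measurable f → (∀ x, |f x| ≤ 1) →
      (∀ x y, |f x - f y| ≤ L * |x - y|) → ∀ᵐ ω ∂P, Tendsto
        (fun N => blockSum f (m N) (k N) (X N ω) / (m N * k N : ℕ)) atTop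
        (nhds (∫ x, f x ∂gaussianReal 0 1)) := by
    intro f L hf hf1 hfL
    have h : ∀ n : ℕ, ∀ᵐ ω ∂P, ∀ᶠ N in atTop,
        |blockSum f (m N) (k N) (X N ω) - (m N * k N : ℕ) * ∫ x, f x ∂gaussianReal 0 1|
          < 1 / (n + 1 : ℝ) * (m N * k N : ℕ) := fun n => by
      obtain ⟨c, hc, η, hη, hbound⟩ := exists_orthogonal_blockSum_deviation_le hf hf1 hfL
        (Nat.one_div_pos_of_nat (α := ℝ) (n := n))
      simpa only [Set.mem_ofPred_eq, not_le] using
        ae_eventually_blockSum_notMem hα hp hμ_prob hμ_supp hμ_inv hX_meas hX_law hf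
          (T := fun p => {x | 1 / (n + 1 : ℝ) * p ≤ |x - p * ∫ x, f x ∂gaussianReal 0 1|})
          (fun p => measurableSet_le measurable_const (by fun_prop)) hc hη hbound
    filter_upwards [ae_all_iff.2 h] with ω hω
    refine Metric.tendsto_nhds.2 fun ε hε => ?_
    obtain ⟨n, hn⟩ := exists_nat_one_div_lt hε
    filter_upwards [hω n, hmk] with N hN hN0
    have hpos : (0 : ℝ) < (m N * k N : ℕ) := by exact_mod_cast hN0
    rw [Real.dist_eq, div_sub' hpos.ne', abs_div, abs_of_pos hpos, div_lt_iff₀ hpos]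
    exact hN.trans (by gcongr)
  obtain ⟨K, -, η, hη, hbound⟩ := exists_orthogonal_blockSum_sq_le
  have hsq := ae_eventually_blockSum_notMem hα hp hμ_prob hμ_supp hμ_inv hX_meas hX_law
    (measurable_id.pow_const 2) (T := fun p => Set.Ici (K * p)) (fun p => measurableSet_Ici)
    one_pos hη hbound
  have hcos : ∀ᵐ ω ∂P, ∀ q : ℚ, _ := ae_all_iff.2 fun q : ℚ =>
    key (f := fun x => Real.cos (q * x)) (L := |(q : ℝ)|) (by fun_prop)
      (fun x => Real.abs_cos_le_one _) fun x y => by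
        simpa only [← mul_sub, abs_mul] using abs_cos_sub_cos_le (q * x) (q * y)
  have hsin : ∀ᵐ ω ∂P, ∀ q : ℚ, _ := ae_all_iff.2 fun q : ℚ =>
    key (f := fun x => Real.sin (q * x)) (L := |(q : ℝ)|) (by fun_prop)
      (fun x => Real.abs_sin_le_one _) fun x y => by
        simpa only [← mul_sub, abs_mul] using abs_sin_sub_sin_le (q * x) (q * y)
  filter_upwards [hsq, hcos, hsin] with ω h1 h2 h3
  exact tendsto_empPM_of_blockSum _ hmk
    (h1.mono fun N hN => (not_le.1 hN).le) h2 h3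
end

section
/- Let m = m_N and k = k_N satisfy m = o(N) and k = o(N), and let R_N be a sequence with R_N = o(N^{1/2}). For N ≥ m+k define f_N : ℝ^{m×k} → [0,∞) by f_N(A) = (Γ_m(N/2) / (π^{mk/2}·Γ_m((N−k)/2)))·det(Id_m − A·Aᵀ)^{(N−k−m−1)/2}·1{‖A·Aᵀ‖_op < 1}, and set g_N(B) = N^{−mk/2}·f_N(B/√N) and φ_N(B) = (2π)^{−mk/2}·exp(−‖B‖_F²/2) for B ∈ ℝ^{m×k}. Then there exists a constant C > 0 such that for all sufficiently large N, sup over B ∈ ℝ^{m×k} with ‖B‖_F ≤ R_N of |log(g_N(B)/φ_N(B))| ≤ C·(R_N⁴/N + m·k·(m+k)/N + (k+m)·R_N²/N). -/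
open MeasureTheory Filter Matrix Asymptotics

/-- The multivariate gamma function `Γ_m(x) = π^{m(m-1)/4} ∏_{i=1}^m Γ(x - (i-1)/2)`. -/
noncomputable def mvGamma (m : ℕ) (x : ℝ) : ℝ :=
  Real.pi ^ ((m : ℝ) * ((m : ℝ) - 1) / 4) *
    ∏ i ∈ Finset.range m, Real.Gamma (x - (i : ℝ) / 2)

/-- Squared Frobenius norm of a matrix. -/
def frobSq {m k : ℕ} (B : Matrix (Fin m) (Fin k) ℝ) : ℝ :=
  ∑ i, ∑ j, (B i j) ^ 2

/-- Frobenius norm of a matrix. -/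
noncomputable def frobNorm {m k : ℕ} (B : Matrix (Fin m) (Fin k) ℝ) : ℝ :=
  Real.sqrt (frobSq B)

/-- The `ℓ² → ℓ²` operator norm of a matrix. -/
noncomputable def opNorm {m k : ℕ} (A : Matrix (Fin m) (Fin k) ℝ) : ℝ :=
  ‖LinearMap.toContinuousLinearMap (Matrix.toEuclideanLin A)‖

/-- The density `f_N` of the upper-left `m × k` block of a Haar orthogonal `N × N` matrix:
`f_N(A) = (Γ_m(N/2) / (π^{mk/2} Γ_m((N-k)/2))) det(Id_m - AAᵀ)^{(N-k-m-1)/2} 1{‖AAᵀ‖_op < 1}`. -/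
noncomputable def fDens (N m k : ℕ) (A : Matrix (Fin m) (Fin k) ℝ) : ℝ :=
  (mvGamma m ((N : ℝ) / 2) / (Real.pi ^ ((m * k : ℝ) / 2) * mvGamma m (((N : ℝ) - k) / 2))) *
    (Matrix.det (1 - A * Aᵀ)) ^ (((N : ℝ) - k - m - 1) / 2) *
    (if opNorm (A * Aᵀ) < 1 then 1 else 0)

/-- The density `g_N(B) = N^{-mk/2} f_N(B/√N)` of the block scaled by `√N`. -/
noncomputable def gDens (N m k : ℕ) (B : Matrix (Fin m) (Fin k) ℝ) : ℝ :=
  (N : ℝ) ^ (-(m * k : ℝ) / 2) * fDens N m k ((Real.sqrt N)⁻¹ • B)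

/-- The standard Gaussian density `φ_N(B) = (2π)^{-mk/2} exp(-‖B‖_F²/2)` on `m × k` matrices. -/
noncomputable def phiDens (m k : ℕ) (B : Matrix (Fin m) (Fin k) ℝ) : ℝ :=
  (2 * Real.pi) ^ (-(m * k : ℝ) / 2) * Real.exp (-frobSq B / 2)
lemma frobSq_nonneg {m k : ℕ} (B : Matrix (Fin m) (Fin k) ℝ) : 0 ≤ frobSq B :=
  Finset.sum_nonneg fun _ _ => Finset.sum_nonneg fun _ _ => sq_nonneg _

lemma frobSq_smul {m k : ℕ} (c : ℝ) (B : Matrix (Fin m) (Fin k) ℝ) :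
    frobSq (c • B) = c ^ 2 * frobSq B := by
  simp only [frobSq, Matrix.smul_apply, smul_eq_mul, mul_pow, Finset.mul_sum]

lemma frobSq_mul_transpose_le {m k : ℕ} (A : Matrix (Fin m) (Fin k) ℝ) :
    frobSq (A * Aᵀ) ≤ frobSq A ^ 2 := by
  have h : frobSq A ^ 2 = ∑ i, ∑ j, (∑ l, A i l ^ 2) * (∑ l, A j l ^ 2) := by
    rw [sq, frobSq, Finset.sum_mul_sum]
  rw [h]
  refine Finset.sum_le_sum fun i _ => Finset.sum_le_sum fun j _ => ?_
  simp only [Matrix.mul_apply, Matrix.transpose_apply]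
  exact Finset.sum_mul_sq_le_sq_mul_sq _ _ _

lemma opNorm_le_frobNorm {m k : ℕ} (A : Matrix (Fin m) (Fin k) ℝ) :
    opNorm A ≤ frobNorm A := by
  refine ContinuousLinearMap.opNorm_le_bound _ (Real.sqrt_nonneg _) fun x => ?_
  refine abs_le_of_sq_le_sq' ?_ (mul_nonneg (Real.sqrt_nonneg _) (norm_nonneg _)) |>.2
  change _ ≤ (Real.sqrt (frobSq A) * ‖x‖) ^ 2
  rw [mul_pow, Real.sq_sqrt (frobSq_nonneg A), EuclideanSpace.real_norm_sq_eq,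
    EuclideanSpace.real_norm_sq_eq, frobSq, Finset.sum_mul]
  refine Finset.sum_le_sum fun i _ => ?_
  change (∑ j, A i j * x j) ^ 2 ≤ _
  exact Finset.sum_mul_sq_le_sq_mul_sq _ _ _

lemma opNorm_mul_transpose_le {m k : ℕ} (A : Matrix (Fin m) (Fin k) ℝ) :
    opNorm (A * Aᵀ) ≤ frobSq A :=
  (opNorm_le_frobNorm _).trans
    (Real.sqrt_le_iff.mpr ⟨frobSq_nonneg A, frobSq_mul_transpose_le A⟩)

lemma abs_add_log_one_sub_le {x : ℝ} (h0 : 0 ≤ x) (h1 : x ≤ 1 / 2) :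
    |x + Real.log (1 - x)| ≤ 2 * x ^ 2 := by
  have h := Real.abs_log_sub_add_sum_range_le (x := x) (by rw [abs_of_nonneg h0]; linarith) 1
  simp only [Finset.sum_range_one, abs_of_nonneg h0] at h
  norm_num at h
  refine h.trans ?_
  rw [div_le_iff₀ (by linarith)]
  nlinarith [sq_nonneg x]

lemma det_one_sub_mul_transpose {m k : ℕ} (A : Matrix (Fin m) (Fin k) ℝ)
    (hA : frobSq A ≤ 1 / 2) :
    0 < (1 - A * Aᵀ).det ∧
      |frobSq A + Real.log (1 - A * Aᵀ).det| ≤ 2 * frobSq A ^ 2 := by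
  have hp : (A * Aᵀ).PosSemidef := by
    simpa using Matrix.posSemidef_self_mul_conjTranspose A
  set e := hp.1.eigenvalues with he
  have he0 : ∀ i, 0 ≤ e i := hp.eigenvalues_nonneg
  have hdet : (1 - A * Aᵀ).det = ∏ i, (1 - e i) := by
    have h := congrArg (Polynomial.eval 1) hp.1.charpoly_eq
    rw [Matrix.eval_charpoly, Polynomial.eval_prod] at h
    simpa using h
  have htr : frobSq A = ∑ i, e i := by
    have h := hp.1.trace_eq_sum_eigenvalues
    simp only [RCLike.ofReal_real_eq_id, id_eq] at h
    rw [← he] at h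
    rw [← h]
    simp [frobSq, Matrix.trace, Matrix.mul_apply, sq]
  have he1 : ∀ i, e i ≤ 1 / 2 := fun i =>
    (Finset.single_le_sum (fun j _ => he0 j) (Finset.mem_univ i)).trans (htr ▸ hA)
  have hpos : ∀ i, 0 < 1 - e i := fun i => by linarith [he1 i]
  refine ⟨hdet ▸ Finset.prod_pos fun i _ => hpos i, ?_⟩
  rw [hdet, Real.log_prod (fun i _ => (hpos i).ne'), htr, ← Finset.sum_add_distrib]
  calc |∑ i, (e i + Real.log (1 - e i))|
      ≤ ∑ i, |e i + Real.log (1 - e i)| := Finset.abs_sum_le_sum_abs _ _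
    _ ≤ ∑ i, 2 * e i ^ 2 :=
        Finset.sum_le_sum fun i _ => abs_add_log_one_sub_le (he0 i) (he1 i)
    _ ≤ 2 * (∑ i, e i) ^ 2 := by
        rw [← Finset.mul_sum]
        have := Finset.sum_sq_le_sq_sum_of_nonneg (s := Finset.univ) (f := e) fun i _ => he0 i
        linarith

lemma log_Gamma_add_one {x : ℝ} (hx : 0 < x) :
    Real.log (Real.Gamma (x + 1)) = Real.log x + Real.log (Real.Gamma x) := by
  rw [Real.Gamma_add_one hx.ne', Real.log_mul hx.ne' (Real.Gamma_pos_of_pos hx).ne']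

lemma log_Gamma_add_sub_le {x d : ℝ} (hx : 0 < x) (hd : 0 < d) :
    Real.log (Real.Gamma (x + d)) - Real.log (Real.Gamma x) ≤ d * Real.log (x + d) := by
  have h := Real.convexOn_log_Gamma.slope_mono_adjacent (x := x) (y := x + d) (z := x + d + 1)
    hx (show (0 : ℝ) < x + d + 1 by linarith) (by linarith) (by linarith)
  simp only [Function.comp_apply, log_Gamma_add_one (show 0 < x + d by linarith)] at h
  rw [add_sub_cancel_left, add_sub_cancel_left, div_le_iff₀ hd] at h
  linarith

lemma le_log_Gamma_add_sub {x d : ℝ} (hx : 1 < x) (hd : 0 < d) :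
    d * Real.log (x - 1) ≤ Real.log (Real.Gamma (x + d)) - Real.log (Real.Gamma x) := by
  have h := Real.convexOn_log_Gamma.slope_mono_adjacent (x := x - 1) (y := x) (z := x + d)
    (show (0 : ℝ) < x - 1 by linarith) (show (0 : ℝ) < x + d by linarith)
    (by linarith) (by linarith)
  have h1 := log_Gamma_add_one (show 0 < x - 1 by linarith)
  rw [sub_add_cancel] at h1
  simp only [Function.comp_apply] at h
  rw [add_sub_cancel_left, sub_sub_cancel, div_one, le_div_iff₀ hd, h1,
    add_sub_cancel_right] at h
  linarith

lemma abs_log_Gamma_ratio_sub_le {N k m i : ℝ} (hN : 0 < N) (hk : 1 ≤ k) (hi : 0 ≤ i)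
    (him : i + 1 ≤ m) (hkm : k + m + 2 ≤ N / 2) :
    |Real.log (Real.Gamma (N / 2 - i / 2)) - Real.log (Real.Gamma ((N - k) / 2 - i / 2))
      - k / 2 * Real.log (N / 2)| ≤ 2 * (k * (m + k) / N) := by
  have hx : 1 < (N - k) / 2 - i / 2 := by linarith
  have hu := log_Gamma_add_sub_le (x := (N - k) / 2 - i / 2) (d := k / 2) (by linarith)
    (by linarith)
  have hl := le_log_Gamma_add_sub (d := k / 2) hx (by linarith)
  rw [show (N - k) / 2 - i / 2 + k / 2 = N / 2 - i / 2 by ring] at hu hl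
  have h1 : Real.log (N / 2 - i / 2) ≤ Real.log (N / 2) :=
    Real.log_le_log (by linarith) (by linarith)
  set y := (k + i + 2) / N with hy
  have hy0 : 0 ≤ y := by positivity
  have hy1 : y ≤ 1 / 2 := by
    rw [hy, div_le_iff₀ hN]; linarith
  have h2 : Real.log ((N - k) / 2 - i / 2 - 1) = Real.log (N / 2) + Real.log (1 - y) := by
    rw [← Real.log_mul (by linarith) (by linarith)]
    congr 1
    rw [hy]; field_simp; ring
  have h3 : -(2 * y) ≤ Real.log (1 - y) := by
    have := (abs_le.mp (abs_add_log_one_sub_le hy0 hy1)).1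
    nlinarith
  have hq : 0 ≤ k * (m + k) / N := by
    have : 0 ≤ m := by linarith
    positivity
  have h4 : k * y ≤ 2 * (k * (m + k) / N) := by
    rw [hy, ← mul_div_assoc, ← mul_div_assoc, div_le_div_iff_of_pos_right hN]
    nlinarith
  rw [h2] at hl
  have h5 := mul_le_mul_of_nonneg_left h3 (show 0 ≤ k / 2 by linarith)
  have h6 := mul_le_mul_of_nonneg_left h1 (show 0 ≤ k / 2 by linarith)
  rw [abs_le]
  constructor <;> nlinarith

lemma mvGamma_pos {m : ℕ} {x : ℝ} (hx : (m : ℝ) / 2 ≤ x) : 0 < mvGamma m x := by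
  refine mul_pos (Real.rpow_pos_of_pos Real.pi_pos _) (Finset.prod_pos fun i hi => ?_)
  have : (i : ℝ) < m := by exact_mod_cast Finset.mem_range.mp hi
  exact Real.Gamma_pos_of_pos (by linarith)

lemma log_mvGamma {m : ℕ} {x : ℝ} (hx : (m : ℝ) / 2 ≤ x) :
    Real.log (mvGamma m x) = Real.log (Real.pi ^ ((m : ℝ) * ((m : ℝ) - 1) / 4)) +
      ∑ i ∈ Finset.range m, Real.log (Real.Gamma (x - (i : ℝ) / 2)) := by
  have h : ∀ i ∈ Finset.range m, Real.Gamma (x - (i : ℝ) / 2) ≠ 0 := fun i hi => by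
    have : (i : ℝ) < m := by exact_mod_cast Finset.mem_range.mp hi
    exact (Real.Gamma_pos_of_pos (by linarith)).ne'
  rw [mvGamma, Real.log_mul (Real.rpow_pos_of_pos Real.pi_pos _).ne'
    (Finset.prod_ne_zero_iff.mpr h), Real.log_prod h]

lemma abs_log_mvGamma_ratio_sub_le {N m k : ℕ} (hN : 0 < N) (hk : 1 ≤ k)
    (hkm : (k : ℝ) + m + 2 ≤ N / 2) :
    |Real.log (mvGamma m ((N : ℝ) / 2)) - Real.log (mvGamma m (((N : ℝ) - k) / 2))
      - m * k / 2 * Real.log ((N : ℝ) / 2)| ≤ 2 * ((m : ℝ) * k * (m + k) / N) := by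
  have hN' : (0 : ℝ) < N := by exact_mod_cast hN
  have hk' : (1 : ℝ) ≤ k := by exact_mod_cast hk
  have hm' : (0 : ℝ) ≤ m := by positivity
  rw [log_mvGamma (by linarith), log_mvGamma (by linarith)]
  have h : ∀ a S T L : ℝ, a + S - (a + T) - m * k / 2 * L = S - T - m * (k / 2 * L) := by
    intros; ring
  rw [h, ← Finset.sum_sub_distrib]
  have hc : (m : ℝ) * (k / 2 * Real.log ((N : ℝ) / 2)) =
      ∑ i ∈ Finset.range m, (k : ℝ) / 2 * Real.log ((N : ℝ) / 2) := by simp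
  rw [hc, ← Finset.sum_sub_distrib]
  calc _ ≤ _ := Finset.abs_sum_le_sum_abs _ _
    _ ≤ ∑ i ∈ Finset.range m, 2 * ((k : ℝ) * (m + k) / N) :=
        Finset.sum_le_sum fun i hi => abs_log_Gamma_ratio_sub_le hN' hk' (by positivity)
          (by exact_mod_cast Finset.mem_range.mp hi) hkm
    _ = _ := by simp; ring

lemma log_gDens_div_phiDens {N m k : ℕ} (hN : 0 < N) (hkm : (k : ℝ) + m + 2 ≤ N / 2)
    (B : Matrix (Fin m) (Fin k) ℝ) (hB : frobSq B / N ≤ 1 / 2) :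
    Real.log (gDens N m k B / phiDens m k B) =
      (Real.log (mvGamma m ((N : ℝ) / 2)) - Real.log (mvGamma m (((N : ℝ) - k) / 2))
        - m * k / 2 * Real.log ((N : ℝ) / 2)) +
      (((N : ℝ) - k - m - 1) / 2 *
        Real.log (1 - ((Real.sqrt N)⁻¹ • B) * ((Real.sqrt N)⁻¹ • B)ᵀ).det + frobSq B / 2) := by
  have hN' : (0 : ℝ) < N := by exact_mod_cast hN
  have hfs : frobSq ((Real.sqrt N)⁻¹ • B) = frobSq B / N := by
    rw [frobSq_smul, inv_pow, Real.sq_sqrt hN'.le]; ring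
  set A := (Real.sqrt N)⁻¹ • B with hA
  have hop : opNorm (A * Aᵀ) < 1 := by
    have := opNorm_mul_transpose_le A
    linarith
  obtain ⟨hdet, -⟩ := det_one_sub_mul_transpose A (by linarith)
  have hm' : (0 : ℝ) ≤ m := by positivity
  have hk' : (0 : ℝ) ≤ k := by positivity
  have hG1 : 0 < mvGamma m ((N : ℝ) / 2) := mvGamma_pos (by linarith)
  have hG2 : 0 < mvGamma m (((N : ℝ) - k) / 2) := mvGamma_pos (by linarith)
  have hpi := Real.pi_pos
  have h1 : (N : ℝ) ^ (-(m * k : ℝ) / 2) ≠ 0 := (Real.rpow_pos_of_pos hN' _).ne'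
  have h2 : Real.pi ^ ((m * k : ℝ) / 2) ≠ 0 := (Real.rpow_pos_of_pos hpi _).ne'
  have h3 : (1 - A * Aᵀ).det ^ (((N : ℝ) - k - m - 1) / 2) ≠ 0 :=
    (Real.rpow_pos_of_pos hdet _).ne'
  have h4 : (2 * Real.pi) ^ (-(m * k : ℝ) / 2) ≠ 0 :=
    (Real.rpow_pos_of_pos (by positivity) _).ne'
  rw [gDens, phiDens, fDens, ← hA, if_pos hop, mul_one,
    Real.log_div (mul_ne_zero h1 (mul_ne_zero (div_ne_zero hG1.ne' (mul_ne_zero h2 hG2.ne')) h3))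
      (mul_ne_zero h4 (Real.exp_pos _).ne'),
    Real.log_mul h1 (mul_ne_zero (div_ne_zero hG1.ne' (mul_ne_zero h2 hG2.ne')) h3),
    Real.log_mul (div_ne_zero hG1.ne' (mul_ne_zero h2 hG2.ne')) h3,
    Real.log_div hG1.ne' (mul_ne_zero h2 hG2.ne'), Real.log_mul h2 hG2.ne',
    Real.log_mul h4 (Real.exp_pos _).ne', Real.log_exp, Real.log_rpow hN', Real.log_rpow hpi,
    Real.log_rpow hdet, Real.log_rpow (by positivity), Real.log_mul two_ne_zero hpi.ne',
    Real.log_div hN'.ne' two_ne_zero]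
  ring

lemma abs_log_gDens_div_phiDens_le {N m k : ℕ} (hN : 0 < N) (hm : 1 ≤ m) (hk : 1 ≤ k)
    (hkm : (k : ℝ) + m + 2 ≤ N / 2) (B : Matrix (Fin m) (Fin k) ℝ)
    (hB : frobSq B / N ≤ 1 / 2) :
    |Real.log (gDens N m k B / phiDens m k B)| ≤
      2 * (frobSq B ^ 2 / N + (m : ℝ) * k * (m + k) / N + ((k : ℝ) + m) * frobSq B / N) := by
  have hN' : (0 : ℝ) < N := by exact_mod_cast hN
  have hm' : (1 : ℝ) ≤ m := by exact_mod_cast hm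
  have hk' : (1 : ℝ) ≤ k := by exact_mod_cast hk
  have hfs : frobSq ((Real.sqrt N)⁻¹ • B) = frobSq B / N := by
    rw [frobSq_smul, inv_pow, Real.sq_sqrt hN'.le]; ring
  rw [log_gDens_div_phiDens hN hkm B hB]
  have hG := abs_log_mvGamma_ratio_sub_le (m := m) hN hk hkm
  obtain ⟨-, hD⟩ := det_one_sub_mul_transpose ((Real.sqrt N)⁻¹ • B) (by linarith)
  rw [hfs] at hD
  set L := Real.log (1 - ((Real.sqrt N)⁻¹ • B) * ((Real.sqrt N)⁻¹ • B)ᵀ).det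
  have ht0 : 0 ≤ frobSq B / N := div_nonneg (frobSq_nonneg B) hN'.le
  have hs : frobSq B = N * (frobSq B / N) := by field_simp
  set t := frobSq B / N
  have hL : |L| ≤ 2 * t := by
    have := abs_le.mp hD
    exact abs_le.mpr ⟨by nlinarith, by nlinarith⟩
  have e1 : frobSq B ^ 2 / N = N * t ^ 2 := by rw [hs]; field_simp
  have e2 : ((k : ℝ) + m) * frobSq B / N = (k + m) * t := by rw [hs]; field_simp
  have hmain : |((N : ℝ) - k - m - 1) / 2 * L + frobSq B / 2| ≤ N * t ^ 2 + 2 * ((k + m) * t) := by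
    have e : ((N : ℝ) - k - m - 1) / 2 * L + frobSq B / 2 =
        N / 2 * (t + L) - (k + m + 1) / 2 * L := by rw [hs]; ring
    rw [e]
    refine (abs_sub _ _).trans ?_
    rw [abs_mul, abs_mul, abs_of_pos (by positivity : (0 : ℝ) < N / 2),
      abs_of_pos (by positivity : (0 : ℝ) < ((k : ℝ) + m + 1) / 2)]
    have a1 := mul_le_mul_of_nonneg_left hD (by positivity : (0 : ℝ) ≤ N / 2)
    have a2 := mul_le_mul_of_nonneg_left hL (by positivity : (0 : ℝ) ≤ ((k : ℝ) + m + 1) / 2)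
    nlinarith
  rw [e1, e2]
  have hNt : 0 ≤ (N : ℝ) * t ^ 2 := by positivity
  refine (abs_add_le _ _).trans ?_
  linarith

/-- **Uniform local limit theorem** for the density of the scaled `m_N × k_N` block of a
Haar orthogonal matrix against the Gaussian density. -/
theorem stmt_3
    (m k : ℕ → ℕ) (hm1 : ∀ N, 1 ≤ m N) (hk1 : ∀ N, 1 ≤ k N)
    (hm : (fun N => (m N : ℝ)) =o[atTop] fun N => (N : ℝ))
    (hk : (fun N => (k N : ℝ)) =o[atTop] fun N => (N : ℝ))
    (R : ℕ → ℝ) (hR : R =o[atTop] fun N => (N : ℝ) ^ ((1 : ℝ) / 2)) :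
    ∃ C > (0 : ℝ), ∀ᶠ N : ℕ in atTop,
      ∀ B : Matrix (Fin (m N)) (Fin (k N)) ℝ, frobNorm B ≤ R N →
        |Real.log (gDens N (m N) (k N) B / phiDens (m N) (k N) B)| ≤
          C * (R N ^ 4 / N + (m N : ℝ) * k N * ((m N : ℝ) + k N) / N +
            ((k N : ℝ) + m N) * R N ^ 2 / N) := by
  refine ⟨2, two_pos, ?_⟩
  filter_upwards [hm.bound (c := 1 / 8) (by norm_num), hk.bound (c := 1 / 8) (by norm_num),
    hR.bound (c := 1 / 2) (by norm_num), eventually_ge_atTop 8] with N hmN hkN hRN hN B hB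
  have hN8 : (8 : ℝ) ≤ N := by exact_mod_cast hN
  have hN' : (0 : ℝ) < N := by linarith
  simp only [Real.norm_natCast] at hmN hkN
  rw [← Real.sqrt_eq_rpow, Real.norm_eq_abs, Real.norm_of_nonneg (Real.sqrt_nonneg _)] at hRN
  have hs0 := frobSq_nonneg B
  have hsR : frobSq B ≤ R N ^ 2 := (Real.sqrt_le_left ((Real.sqrt_nonneg _).trans hB)).mp hB
  have hR2 : R N ^ 2 ≤ N / 4 := by
    have h := pow_le_pow_left₀ (abs_nonneg _) hRN 2
    rw [sq_abs, mul_pow, Real.sq_sqrt hN'.le] at h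
    linarith
  refine (abs_log_gDens_div_phiDens_le (by omega) (hm1 N) (hk1 N) (by linarith) B
    (by rw [div_le_iff₀ hN']; linarith)).trans ?_
  have hR4 : frobSq B ^ 2 ≤ R N ^ 4 := by
    calc frobSq B ^ 2 ≤ (R N ^ 2) ^ 2 := pow_le_pow_left₀ hs0 hsR 2
      _ = R N ^ 4 := by ring
  gcongr
end
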